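/- arXiv:2605.23884 — 2 statements merged into one kernel-verified Lean document; each statement's English description precedes it below -/
import Mathlib

section
/- Let μ be a Poisson measure on ℝ^d. Then: (a) μ is strongly almost periodic as a distribution if and only if μ is translation bounded as a distribution; (b) μ is strongly almost periodic as a tempered distribution if and only if μ is translation bounded as a tempered distribution; (c) μ is strongly almost periodic as a measure if and only if μ is a translation-bounded measure. -/
set_option linter.unusedSectionVars false

open MeasureTheory Filter Metric Complex SchwartzMap
open scoped Topology ENNReal NNReal ComplexConjugate

noncomputable section

section Preamble

variable {E : Type*} [NormedAddCommGroup E] [InnerProductSpace ℝ E] [FiniteDimensional ℝ E]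
  [MeasurableSpace E] [BorelSpace E]

/-- A set is relatively dense if it has bounded gaps. -/
def IsRelativelyDense (A : Set E) : Prop :=
  ∃ r : ℝ, ∀ x : E, ∃ a ∈ A, dist x a ≤ r

/-- Bohr almost periodic functions: uniformly continuous, bounded, with relatively
dense sets of ε-almost periods. -/
def IsBohrAP (f : E → ℂ) : Prop :=
  UniformContinuous f ∧ (∃ C : ℝ, ∀ x, ‖f x‖ ≤ C) ∧
    ∀ ε : ℝ, 0 < ε → IsRelativelyDense {t : E | ∀ x, ‖f (x - t) - f x‖ < ε}

/-- Bounded functions. -/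
def IsBddFun (f : E → ℂ) : Prop := ∃ C : ℝ, ∀ x, ‖f x‖ ≤ C

lemma isometry_const_sub (x : E) : Isometry (fun y : E => x - y) :=
  Isometry.of_dist_eq (fun a b => dist_sub_left x a b)

lemma hasTemperateGrowth_const_sub (x : E) :
    Function.HasTemperateGrowth (fun y : E => x - y) := by
  apply Function.HasTemperateGrowth.of_fderiv (k := 1) (C := ‖x‖ + 1)
  · have h : (fderiv ℝ (fun y : E => x - y)) =
        fun _ : E => ((0 : E →L[ℝ] E) - ContinuousLinearMap.id ℝ E) := by
      funext y
      exact ((hasFDerivAt_const x y).sub (hasFDerivAt_id y)).fderiv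
    rw [h]
    exact Function.HasTemperateGrowth.const _
  · exact (differentiable_const x).sub differentiable_id
  · intro y
    have h1 : ‖x - y‖ ≤ ‖x‖ + ‖y‖ := norm_sub_le x y
    have h2 : (0:ℝ) ≤ ‖x‖ := norm_nonneg x
    have h3 : (0:ℝ) ≤ ‖y‖ := norm_nonneg y
    calc ‖x - y‖ ≤ ‖x‖ + ‖y‖ := h1
      _ ≤ (‖x‖ + 1) * (1 + ‖y‖) ^ 1 := by nlinarith

/-- The reflected translate `y ↦ ψ (x - y)` of a Schwartz function. -/
def transRefl (x : E) (ψ : SchwartzMap E ℂ) : SchwartzMap E ℂ :=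
  SchwartzMap.compCLMOfAntilipschitz (K := 1) ℝ (hasTemperateGrowth_const_sub x)
    (isometry_const_sub x).antilipschitz ψ

@[simp] lemma transRefl_apply (x : E) (ψ : SchwartzMap E ℂ) (y : E) :
    transRefl x ψ y = ψ (x - y) := rfl

/-- Convolution of a tempered distribution with a Schwartz function:
`(T * ψ)(x) = T (ψ (x - ·))`. -/
def convTD (T : SchwartzMap E ℂ →L[ℂ] ℂ) (ψ : SchwartzMap E ℂ) : E → ℂ :=
  fun x => T (transRefl x ψ)

/-- Smooth compactly supported test function, regarded inside the Schwartz space. -/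
def IsTestFn (φ : SchwartzMap E ℂ) : Prop := HasCompactSupport ⇑φ

/-- Translation bounded as a tempered distribution. -/
def TransBddTD (T : SchwartzMap E ℂ →L[ℂ] ℂ) : Prop :=
  ∀ ψ : SchwartzMap E ℂ, IsBddFun (convTD T ψ)

/-- Translation bounded as a distribution. -/
def TransBddD (T : SchwartzMap E ℂ →L[ℂ] ℂ) : Prop :=
  ∀ ψ : SchwartzMap E ℂ, IsTestFn ψ → IsBddFun (convTD T ψ)

/-- Strongly almost periodic as a tempered distribution. -/
def SAPTD (T : SchwartzMap E ℂ →L[ℂ] ℂ) : Prop :=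
  ∀ ψ : SchwartzMap E ℂ, IsBohrAP (convTD T ψ)

/-- Strongly almost periodic as a distribution. -/
def SAPD (T : SchwartzMap E ℂ →L[ℂ] ℂ) : Prop :=
  ∀ ψ : SchwartzMap E ℂ, IsTestFn ψ → IsBohrAP (convTD T ψ)

/-- The distributional Fourier transform, `T̂(φ) = T(φ̂)`, with the convention
`φ̂(ξ) = ∫ e^{-2πi⟨x,ξ⟩} φ(x) dx`. -/
def fourierTD (T : SchwartzMap E ℂ →L[ℂ] ℂ) : SchwartzMap E ℂ →L[ℂ] ℂ :=
  T.comp (SchwartzMap.fourierTransformCLM ℂ)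

/-- A complex Radon measure, encoded by its total variation measure together with a
unimodular density (polar decomposition). -/
structure CMeasure (E : Type*) [TopologicalSpace E] [MeasurableSpace E] where
  /-- the total variation measure -/
  tv : Measure E
  locFin : IsLocallyFiniteMeasure tv
  /-- the unimodular density -/
  density : E → ℂ
  density_meas : Measurable density
  density_norm : ∀ᵐ x ∂tv, ‖density x‖ = 1

namespace CMeasure

/-- Pairing of a complex measure with a function: `μ(φ) = ∫ φ dμ`. -/
def pairing (μ : CMeasure E) (φ : E → ℂ) : ℂ := ∫ x, φ x * μ.density x ∂μ.tv

/-- The complex measure agrees with the tempered distribution `T` on all smooth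
compactly supported test functions; i.e. `μ` is a tempered measure identified with `T`. -/
def Agrees (μ : CMeasure E) (T : SchwartzMap E ℂ →L[ℂ] ℂ) : Prop :=
  ∀ φ : SchwartzMap E ℂ, IsTestFn φ → T φ = μ.pairing ⇑φ

/-- A tempered measure is one that extends to a tempered distribution. -/
def IsTempered (μ : CMeasure E) : Prop := ∃ T, μ.Agrees T

/-- Pure point measure: concentrated on a countable set. -/
def IsPurePoint (μ : CMeasure E) : Prop := ∃ S : Set E, S.Countable ∧ μ.tv Sᶜ = 0

/-- Convolution of a complex measure with a function: `(μ * φ)(x) = ∫ φ(x - y) dμ(y)`. -/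
def convM (μ : CMeasure E) (φ : E → ℂ) : E → ℂ :=
  fun x => ∫ y, φ (x - y) * μ.density y ∂μ.tv

/-- Translation bounded as a measure. -/
def TransBddM (μ : CMeasure E) : Prop :=
  ∀ φ : E → ℂ, Continuous φ → HasCompactSupport φ → IsBddFun (μ.convM φ)

/-- Strongly almost periodic as a measure. -/
def SAPM (μ : CMeasure E) : Prop :=
  ∀ φ : E → ℂ, Continuous φ → HasCompactSupport φ → IsBohrAP (μ.convM φ)

/-- Strongly tempered measure: the total variation has polynomial growth,
equivalently `|μ|` is a tempered (slowly increasing) measure. -/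
def IsStronglyTempered (μ : CMeasure E) : Prop :=
  ∃ C a : ℝ, ∀ r : ℝ, 1 ≤ r → μ.tv (Metric.closedBall 0 r) ≤ ENNReal.ofReal (C * r ^ a)

/-- The atom of a complex measure at a point: `μ({x})`. -/
def atom (μ : CMeasure E) (x : E) : ℂ := (μ.tv {x}).toReal • μ.density x

/-- The measure is concentrated on a locally finite set. -/
def LocallyFiniteSupport (μ : CMeasure E) : Prop :=
  ∃ S : Set E, (∀ K : Set E, IsCompact K → (S ∩ K).Finite) ∧ μ.tv Sᶜ = 0

end CMeasure

end Preamble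

section Work
variable {E : Type*} [NormedAddCommGroup E] [InnerProductSpace ℝ E] [FiniteDimensional ℝ E]
  [MeasurableSpace E] [BorelSpace E]

lemma isBohrAP_of_approx {f : E → ℂ}
    (h : ∀ ε : ℝ, 0 < ε → ∃ g : E → ℂ, IsBohrAP g ∧ ∀ x, ‖f x - g x‖ ≤ ε) : IsBohrAP f := by
  refine ⟨?_, ?_, ?_⟩
  · rw [Metric.uniformContinuous_iff]
    intro ε hε
    obtain ⟨g, hg, hfg⟩ := h (ε / 4) (by linarith)
    obtain ⟨δ, hδ, hg'⟩ := Metric.uniformContinuous_iff.1 hg.1 (ε / 4) (by linarith)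
    refine ⟨δ, hδ, fun {a b} hab => ?_⟩
    have h1 := hg' hab
    have h2 := hfg a
    have h3 := hfg b
    rw [dist_eq_norm] at *
    have : f a - f b = (f a - g a) + (g a - g b) - (f b - g b) := by ring
    rw [this]
    have h4 := norm_sub_le ((f a - g a) + (g a - g b)) (f b - g b)
    have h5 := norm_add_le (f a - g a) (g a - g b)
    linarith
  · obtain ⟨g, hg, hfg⟩ := h 1 one_pos
    obtain ⟨C, hC⟩ := hg.2.1
    refine ⟨C + 1, fun x => ?_⟩
    have : f x = g x + (f x - g x) := by ring
    rw [this]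
    exact (norm_add_le _ _).trans (add_le_add (hC x) (hfg x))
  · intro ε hε
    obtain ⟨g, hg, hfg⟩ := h (ε / 4) (by linarith)
    obtain ⟨r, hr⟩ := hg.2.2 (ε / 4) (by linarith)
    refine ⟨r, fun x => ?_⟩
    obtain ⟨t, ht, hxt⟩ := hr x
    refine ⟨t, fun y => ?_, hxt⟩
    have h1 : ‖g (y - t) - g y‖ < ε / 4 := ht y
    have h2 := hfg (y - t)
    have h3 := hfg y
    have : f (y - t) - f y = (f (y - t) - g (y - t)) + (g (y - t) - g y) - (f y - g y) := by ring
    rw [this]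
    have h4 := norm_sub_le ((f (y - t) - g (y - t)) + (g (y - t) - g y)) (f y - g y)
    have h5 := norm_add_le (f (y - t) - g (y - t)) (g (y - t) - g y)
    linarith

/-- the character -/
def chr (s x : E) : ℂ := ((Real.fourierChar (inner ℝ x s) : Circle) : ℂ)

lemma norm_chr (s x : E) : ‖chr s x‖ = 1 := Circle.norm_coe _

lemma chr_add (s x y : E) : chr s (x + y) = chr s x * chr s y := by
  simp [chr, inner_add_left, AddChar.map_add_eq_mul]

lemma chr_zero (s : E) : chr s 0 = 1 := by simp [chr]

lemma continuous_chr (s : E) : Continuous (chr s) := by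
  unfold chr
  exact continuous_subtype_val.comp (Real.continuous_fourierChar.comp (by fun_prop))

lemma chr_sub_norm (s x y : E) : ‖chr s x - chr s y‖ = ‖chr s (x - y) - 1‖ := by
  have : chr s x = chr s (x - y) * chr s y := by rw [← chr_add]; simp
  rw [this, show chr s (x - y) * chr s y - chr s y = (chr s (x - y) - 1) * chr s y by ring,
    norm_mul, norm_chr, mul_one]

lemma uniformContinuous_chr (s : E) : UniformContinuous (chr s) := by
  rw [Metric.uniformContinuous_iff]
  intro ε hε
  obtain ⟨δ, hδ, h⟩ := Metric.continuous_iff.1 (continuous_chr s) 0 ε hε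
  refine ⟨δ, hδ, fun {a b} hab => ?_⟩
  rw [dist_eq_norm, chr_sub_norm]
  have := h (a - b) (by rwa [dist_zero_right, ← dist_eq_norm])
  rwa [chr_zero, dist_eq_norm] at this

lemma chr_periods (F : Finset E) (ε : ℝ) (hε : 0 < ε) :
    IsRelativelyDense {t : E | ∀ s ∈ F, ‖chr s t - 1‖ < ε} := by
  let Φ : E → (F → ℂ) := fun t s => chr (s : E) t
  have htb : TotallyBounded (Set.range Φ) := by
    refine TotallyBounded.subset ?_ (isCompact_closedBall (0 : F → ℂ) 1).totallyBounded
    rintro _ ⟨t, rfl⟩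
    rw [mem_closedBall_zero_iff, pi_norm_le_iff_of_nonneg zero_le_one]
    intro s
    exact (norm_chr _ _).le
  obtain ⟨c, hc, hcf, hcov⟩ := Metric.finite_approx_of_totallyBounded htb ε hε
  have hch : ∀ z : c, ∃ t, Φ t = z := fun z => hc z.2
  choose τ hτ using hch
  have : Finite c := hcf
  obtain ⟨r, hr⟩ := (Set.finite_range (fun z => ‖τ z‖)).bddAbove
  refine ⟨r, fun x => ?_⟩
  have hx := hcov ⟨x, rfl⟩
  simp only [Set.mem_iUnion] at hx
  obtain ⟨z, hz, hxz⟩ := hx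
  refine ⟨x - τ ⟨z, hz⟩, fun s hs => ?_, ?_⟩
  · rw [← chr_sub_norm]
    have h1 := (dist_le_pi_dist (Φ x) z ⟨s, hs⟩).trans_lt hxz
    rw [← show Φ (τ ⟨z, hz⟩) = z from hτ ⟨z, hz⟩, dist_eq_norm] at h1
    exact h1
  · rw [dist_eq_norm, sub_sub_cancel]
    exact hr ⟨_, rfl⟩

lemma isBohrAP_trigPoly (F : Finset E) (a : E → ℂ) :
    IsBohrAP (fun x => ∑ s ∈ F, a s * chr s x) := by
  refine ⟨?_, ⟨∑ s ∈ F, ‖a s‖, fun x => ?_⟩, fun ε hε => ?_⟩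
  · classical
    induction F using Finset.induction_on with
    | empty => simpa using uniformContinuous_const
    | insert s F hs ih =>
      simp only [Finset.sum_insert hs]
      refine UniformContinuous.add ?_ ih
      exact (uniformContinuous_chr s).const_smul (a s)
  · refine (norm_sum_le _ _).trans (Finset.sum_le_sum fun s _ => ?_)
    rw [norm_mul, norm_chr, mul_one]
  · set M : ℝ := ∑ s ∈ F, ‖a s‖ with hM
    have hM0 : 0 ≤ M := Finset.sum_nonneg fun _ _ => norm_nonneg _
    have hM1 : 0 < M + 1 := by linarith
    obtain ⟨r, hr⟩ := chr_periods F (ε / (M + 1)) (by positivity)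
    refine ⟨r, fun x => ?_⟩
    obtain ⟨t, ht, hxt⟩ := hr x
    refine ⟨t, fun y => ?_, hxt⟩
    rw [← Finset.sum_sub_distrib]
    calc ‖∑ s ∈ F, (a s * chr s (y - t) - a s * chr s y)‖
        ≤ ∑ s ∈ F, ‖a s‖ * (ε / (M + 1)) := by
          refine (norm_sum_le _ _).trans (Finset.sum_le_sum fun s hs => ?_)
          rw [← mul_sub, norm_mul, norm_sub_rev, chr_sub_norm, sub_sub_cancel]
          exact mul_le_mul_of_nonneg_left (ht s hs).le (norm_nonneg _)
      _ = M * (ε / (M + 1)) := by rw [← Finset.sum_mul]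
      _ < (M + 1) * (ε / (M + 1)) := by
          apply mul_lt_mul_of_pos_right (by linarith) (by positivity)
      _ = ε := by field_simp

/-- integrals of characters against finite pure point measures -/
lemma isBohrAP_integral_chr (ν : CMeasure E) (hν : ν.IsPurePoint) (h : E → ℂ)
    (hc : Continuous h) (hs : HasCompactSupport h) :
    IsBohrAP (fun x => ∫ s, (chr s x * h s) * ν.density s ∂ν.tv) := by
  have := ν.locFin
  obtain ⟨S, hS, hS0⟩ := hν
  have hae : ν.tv = ν.tv.restrict S := by
    rw [Measure.restrict_eq_self_of_ae_mem]
    exact hS0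
  have hh : Integrable h ν.tv := hc.integrable_of_hasCompactSupport hs
  have hint : ∀ g : E → ℂ, Measurable g → (∀ s, ‖g s‖ ≤ 1) →
      Integrable (fun s => (g s * h s) * ν.density s) ν.tv := by
    intro g hg hg1
    refine hh.mono ?_ ?_
    · exact ((hg.mul hc.measurable).mul ν.density_meas).aestronglyMeasurable
    · filter_upwards [ν.density_norm] with s hs
      rw [norm_mul, hs, mul_one, norm_mul]
      exact mul_le_of_le_one_left (norm_nonneg _) (hg1 s)
  have : Countable S := hS.to_subtype
  have hU : (⋃ s : S, ({(s : E)} : Set E)) = S := by simp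
  have key : ∀ g : E → ℂ, Integrable g ν.tv →
      HasSum (fun s : S => ν.tv.real {(s : E)} • g s) (∫ s, g s ∂ν.tv) := by
    intro g hg
    have := hasSum_integral_iUnion (μ := ν.tv) (f := g) (s := fun s : S => ({(s : E)} : Set E))
      (fun s => measurableSet_singleton _) ?_ hg.integrableOn
    · rw [hU, ← hae] at this
      simpa only [integral_singleton] using this
    · intro a b hab
      simpa [Function.onFun] using fun hh => hab (Subtype.ext hh)
  have hsum : Summable (fun s : S => ‖ν.tv.real {(s : E)} • (h s * ν.density s)‖) := by
    have h1 := hint (fun _ => 1) measurable_const (by simp)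
    simp only [one_mul] at h1
    exact (key _ h1).summable.norm
  have hx : ∀ x : E, HasSum (fun s : S => (ν.tv.real {(s : E)} • (h s * ν.density s)) * chr (s : E) x)
      (∫ s, (chr s x * h s) * ν.density s ∂ν.tv) := by
    intro x
    have h1 := key _ (hint (fun s => chr s x) ?_ (fun s => (norm_chr s x).le))
    · convert h1 using 1
      funext s
      simp only [Complex.real_smul]
      ring
    · have : Continuous (fun s => chr s x) := by
        unfold chr
        exact continuous_subtype_val.comp (Real.continuous_fourierChar.comp (by fun_prop))
      exact this.measurable
  have hunif := tendstoUniformly_tsum hsum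
    (f := fun (s : S) (x : E) => (ν.tv.real {(s : E)} • (h s * ν.density s)) * chr (s : E) x)
    (fun s x => by rw [norm_mul, norm_chr, mul_one])
  apply isBohrAP_of_approx
  intro ε hε
  obtain ⟨t, ht⟩ := (Metric.tendstoUniformly_iff.1 hunif ε hε).exists
  refine ⟨_, isBohrAP_trigPoly (t.map (Function.Embedding.subtype _))
    (fun s => ν.tv.real {s} • (h s * ν.density s)), fun x => ?_⟩
  have := ht x
  rw [(hx x).tsum_eq, dist_eq_norm] at this
  rw [Finset.sum_map]
  exact this.le

lemma toSchwartz_apply {f : E → ℂ} (h₁ : HasCompactSupport f) (h₂ : ContDiff ℝ ((⊤ : ℕ∞) : WithTop ℕ∞) f) (x : E) :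
    (h₁.toSchwartzMap h₂) x = f x := rfl

lemma contDiff_chr (x : E) : ContDiff ℝ ((⊤ : ℕ∞) : WithTop ℕ∞) (fun s : E => chr s x) := by
  unfold chr
  simp only [Real.fourierChar_apply]
  have h1 : ContDiff ℝ ((⊤ : ℕ∞) : WithTop ℕ∞) (fun s : E => (inner ℝ x s : ℝ)) :=
    contDiff_const.inner ℝ contDiff_id
  have h2 : ContDiff ℝ ((⊤ : ℕ∞) : WithTop ℕ∞) (fun s : E => ((2 * Real.pi * inner ℝ x s : ℝ) : ℂ)) :=
    Complex.ofRealCLM.contDiff.comp (contDiff_const.mul h1)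
  exact (h2.mul contDiff_const).cexp

lemma convTD_eq_of_fourier (T : SchwartzMap E ℂ →L[ℂ] ℂ) (ν : CMeasure E)
    (hν : ν.Agrees (fourierTD T)) (ψ : SchwartzMap E ℂ)
    (hψ : IsTestFn (SchwartzMap.fourierTransformCLM ℂ ψ)) (x : E) :
    convTD T ψ x =
      ∫ s, (chr s x * SchwartzMap.fourierTransformCLM ℂ ψ s) * ν.density s ∂ν.tv := by
  set h := SchwartzMap.fourierTransformCLM ℂ ψ with hh
  have hcs : HasCompactSupport (fun s => chr s x * h s) := hψ.mul_left
  have hcd : ContDiff ℝ ((⊤ : ℕ∞) : WithTop ℕ∞) (fun s => chr s x * h s) :=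
    (contDiff_chr x).mul (h.smooth _)
  set g : SchwartzMap E ℂ := hcs.toSchwartzMap hcd with hg
  have h1 : transRefl x ψ = SchwartzMap.fourierTransformCLM ℂ g := by
    ext y
    have hinv : ψ = FourierTransformInv.fourierInv h := by
      rw [hh, SchwartzMap.fourierTransformCLM_apply, FourierTransform.fourierInv_fourier_eq]
    rw [transRefl_apply, SchwartzMap.fourierTransformCLM_apply, SchwartzMap.fourier_coe]
    conv_lhs => rw [hinv]
    rw [SchwartzMap.fourierInv_coe, Real.fourierInv_eq, Real.fourier_eq]
    refine integral_congr_ae (Eventually.of_forall fun s => ?_)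
    simp only [hg, toSchwartz_apply, Circle.smul_def, smul_eq_mul]
    rw [← mul_assoc]
    congr 1
    unfold chr
    rw [← Circle.coe_mul, ← AddChar.map_add_eq_mul, inner_sub_right, real_inner_comm s x]
    congr 2
    ring
  have h2 := hν g hcs
  unfold convTD
  rw [h1]
  exact h2

lemma isBohrAP_convTD_of_fourier (T : SchwartzMap E ℂ →L[ℂ] ℂ) (ν : CMeasure E)
    (hν : ν.Agrees (fourierTD T)) (hνpp : ν.IsPurePoint) (ψ : SchwartzMap E ℂ)
    (hψ : IsTestFn (SchwartzMap.fourierTransformCLM ℂ ψ)) : IsBohrAP (convTD T ψ) := by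
  have : convTD T ψ = fun x =>
      ∫ s, (chr s x * SchwartzMap.fourierTransformCLM ℂ ψ s) * ν.density s ∂ν.tv :=
    funext fun x => convTD_eq_of_fourier T ν hν ψ hψ x
  rw [this]
  exact isBohrAP_integral_chr ν hνpp _ (SchwartzMap.continuous _) hψ

lemma leibniz_bound {f g : E → ℂ} (hf : ContDiff ℝ ((⊤ : ℕ∞) : WithTop ℕ∞) f)
    (hg : ContDiff ℝ ((⊤ : ℕ∞) : WithTop ℕ∞) g) (x : E) (n : ℕ) {M P : ℝ}
    (hM : ∀ i ≤ n, ‖iteratedFDeriv ℝ i f x‖ ≤ M) (hP : ∀ i ≤ n, ‖iteratedFDeriv ℝ i g x‖ ≤ P) :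
    ‖iteratedFDeriv ℝ n (fun y => f y * g y) x‖ ≤ 2 ^ n * (M * P) := by
  have hM0 : 0 ≤ M := (norm_nonneg _).trans (hM 0 (Nat.zero_le _))
  refine (norm_iteratedFDeriv_mul_le hf hg x (n := n) (by exact_mod_cast le_top)).trans ?_
  calc _ ≤ ∑ i ∈ Finset.range (n + 1), (n.choose i : ℝ) * (M * P) := by
        refine Finset.sum_le_sum fun i hi => ?_
        rw [mul_assoc]
        refine mul_le_mul_of_nonneg_left ?_ (Nat.cast_nonneg _)
        exact mul_le_mul (hM i (by simpa [Nat.lt_succ_iff] using hi)) (hP _ (Nat.sub_le _ _))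
          (norm_nonneg _) hM0
    _ = 2 ^ n * (M * P) := by
        rw [← Finset.sum_mul]
        congr 1
        exact_mod_cast Nat.sum_range_choose n

/-- derivative bounds of test functions -/
lemma testfn_bound {f : E → ℂ} (hs : HasCompactSupport f)
    (hf : ContDiff ℝ ((⊤ : ℕ∞) : WithTop ℕ∞) f) (n : ℕ) :
    ∃ M : ℝ, ∀ i ≤ n, ∀ x, ‖iteratedFDeriv ℝ i f x‖ ≤ M := by
  have h : ∀ i, ∃ M : ℝ, ∀ x, ‖iteratedFDeriv ℝ i f x‖ ≤ M := fun i =>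
    ⟨_, fun x => SchwartzMap.norm_iteratedFDeriv_le_seminorm ℝ (hs.toSchwartzMap hf) i x⟩
  choose M hM using h
  refine ⟨∑ i ∈ Finset.range (n + 1), M i, fun i hi x => (hM i x).trans ?_⟩
  exact Finset.single_le_sum (f := M) (fun j _ => (norm_nonneg _).trans (hM j x))
    (Finset.mem_range.2 (Nat.lt_succ_of_le hi))

/-- cutoffs -/
lemma exists_cutoff : ∃ f : E → ℂ, HasCompactSupport f ∧ ContDiff ℝ ((⊤ : ℕ∞) : WithTop ℕ∞) f ∧
    ∀ x, ‖x‖ ≤ 1 → f x = 1 := by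
  let b : ContDiffBump (0 : E) := ⟨1, 2, one_pos, one_lt_two⟩
  refine ⟨fun x => (b x : ℂ), b.hasCompactSupport.comp_left Complex.ofReal_zero,
    Complex.ofRealCLM.contDiff.comp b.contDiff, fun x hx => ?_⟩
  have := b.one_of_mem_closedBall (x := x) (by simpa [b] using hx)
  simp [this]

lemma testfn_dense (ψ : SchwartzMap E ℂ) :
    ∃ φ : ℕ → SchwartzMap E ℂ, (∀ n, IsTestFn (φ n)) ∧ Tendsto φ atTop (𝓝 ψ) := by
  obtain ⟨f, hfs, hf, hf1⟩ := exists_cutoff (E := E)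
  let c : ℕ → ℝ := fun m => ((m : ℝ) + 1)⁻¹
  have hc0 : ∀ m, 0 < c m := fun m => by positivity
  have hc1 : ∀ m, c m ≤ 1 := fun m => inv_le_one_of_one_le₀ (by simp)
  have hfc : ∀ m, ContDiff ℝ ((⊤ : ℕ∞) : WithTop ℕ∞) (fun x => f (c m • x)) := fun m =>
    hf.comp (contDiff_const_smul _)
  have hs : ∀ m, HasCompactSupport (fun x => f (c m • x) * ψ x) := fun m =>
    (hfs.comp_homeomorph (Homeomorph.smulOfNeZero (c m) (hc0 m).ne')).mul_right
  refine ⟨fun m => (hs m).toSchwartzMap ((hfc m).mul (ψ.smooth _)), fun m => hs m, ?_⟩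
  rw [(schwartz_withSeminorms ℂ E ℂ).tendsto_nhds]
  rintro ⟨k, n⟩ ε hε
  obtain ⟨M, hM⟩ := testfn_bound hfs hf n
  have hM0 : 0 ≤ M := (norm_nonneg _).trans (hM 0 (Nat.zero_le _) 0)
  set P : ℝ := ∑ i ∈ Finset.range (n + 1), SchwartzMap.seminorm ℂ (k + 1) i ψ with hP
  have hP0 : 0 ≤ P := Finset.sum_nonneg fun i _ => apply_nonneg _ _
  have hbound : ∀ m, SchwartzMap.seminorm ℂ k n
      ((hs m).toSchwartzMap ((hfc m).mul (ψ.smooth _)) - ψ) ≤ c m * (2 ^ n * ((M + 1) * P)) := by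
    intro m
    refine SchwartzMap.seminorm_le_bound ℂ k n _ (by have := hc0 m; positivity) fun x => ?_
    have heq : (⇑((hs m).toSchwartzMap ((hfc m).mul (ψ.smooth _)) - ψ) : E → ℂ) =
        fun y => (f (c m • y) - 1) * ψ y := by
      funext y
      change f (c m • y) * ψ y - ψ y = _
      ring
    rw [heq]
    by_cases hx : ‖c m • x‖ < 1
    · have hz : (fun y => (f (c m • y) - 1) * ψ y) =ᶠ[𝓝 x] fun _ => (0 : ℂ) := by
        have : ∀ᶠ y in 𝓝 x, ‖c m • y‖ < 1 :=
          (continuous_const_smul (c m)).norm.continuousAt.eventually_lt continuousAt_const hx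
        filter_upwards [this] with y hy
        rw [hf1 _ hy.le]; ring
      rw [(Filter.EventuallyEq.iteratedFDeriv (𝕜 := ℝ) hz n).eq_of_nhds, iteratedFDeriv_fun_zero]
      have := hc0 m
      simp only [Pi.zero_apply, norm_zero, mul_zero]
      positivity
    · push Not at hx
      rw [norm_smul, Real.norm_of_nonneg (hc0 m).le] at hx
      have hM' : ∀ i ≤ n, ‖iteratedFDeriv ℝ i (fun y => f (c m • y) - 1) x‖ ≤ M + 1 := by
        intro i hi
        have h1 : ‖iteratedFDeriv ℝ i (fun y => f (c m • y)) x‖ ≤ M := by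
          rw [iteratedFDeriv_comp_const_smul (c m) (hf.of_le (by exact_mod_cast le_top))]
          rw [norm_smul, norm_pow, Real.norm_of_nonneg (hc0 m).le]
          exact (mul_le_of_le_one_left (norm_nonneg _)
            (pow_le_one₀ (hc0 m).le (hc1 m))).trans (hM i hi _)
        have h2 : ‖iteratedFDeriv ℝ i (fun _ : E => (1 : ℂ)) x‖ ≤ 1 := by
          rcases Nat.eq_zero_or_pos i with rfl | hi0
          · simp
          · rw [iteratedFDeriv_const_of_ne hi0.ne']; simp
        have h3 : iteratedFDeriv ℝ i (fun y => f (c m • y) - 1) x =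
            iteratedFDeriv ℝ i (fun y => f (c m • y)) x -
              iteratedFDeriv ℝ i (fun _ : E => (1 : ℂ)) x := by
          exact iteratedFDeriv_sub_apply ((hfc m).contDiffAt.of_le (by exact_mod_cast le_top))
            contDiffAt_const
        rw [h3]
        exact (norm_sub_le _ _).trans (add_le_add h1 h2)
      have hP' : ∀ i ≤ n, ‖x‖ ^ (k + 1) * ‖iteratedFDeriv ℝ i ψ x‖ ≤ P := by
        intro i hi
        refine (SchwartzMap.le_seminorm ℂ (k + 1) i ψ x).trans ?_
        exact Finset.single_le_sum (f := fun i => SchwartzMap.seminorm ℂ (k + 1) i ψ)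
          (fun j _ => apply_nonneg _ _) (Finset.mem_range.2 (Nat.lt_succ_of_le hi))
      have hxpos : 0 < ‖x‖ := by
        by_contra hcon
        have : ‖x‖ = 0 := le_antisymm (not_lt.1 hcon) (norm_nonneg _)
        rw [this] at hx; norm_num at hx
      have hxk : 0 < ‖x‖ ^ (k + 1) := by positivity
      have hl := leibniz_bound (f := fun y => f (c m • y) - 1) (g := ψ)
        ((hfc m).sub contDiff_const) (ψ.smooth _) x n hM'
        (P := P / ‖x‖ ^ (k + 1)) (fun i hi => by
          rw [le_div_iff₀ hxk, mul_comm]; exact hP' i hi)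
      calc ‖x‖ ^ k * _ ≤ ‖x‖ ^ k * (2 ^ n * ((M + 1) * (P / ‖x‖ ^ (k + 1)))) :=
            mul_le_mul_of_nonneg_left hl (by positivity)
        _ = (1 / ‖x‖) * (2 ^ n * ((M + 1) * P)) := by
            field_simp
            ring
        _ ≤ c m * (2 ^ n * ((M + 1) * P)) := by
            refine mul_le_mul_of_nonneg_right ?_ (by positivity)
            rw [div_le_iff₀ hxpos]; exact hx
  have hlim : Tendsto (fun m => c m * (2 ^ n * ((M + 1) * P))) atTop (𝓝 0) := by
    have := (tendsto_one_div_add_atTop_nhds_zero_nat (𝕜 := ℝ)).mul_const (2 ^ n * ((M + 1) * P))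
    simpa [c] using this
  filter_upwards [hlim.eventually_lt_const hε] with m hm
  exact (hbound m).trans_lt hm

lemma fourier_testfn_dense (ψ : SchwartzMap E ℂ) :
    ∃ φ : ℕ → SchwartzMap E ℂ, (∀ n, IsTestFn (SchwartzMap.fourierTransformCLM ℂ (φ n))) ∧
      Tendsto φ atTop (𝓝 ψ) := by
  obtain ⟨φ, h1, h2⟩ := testfn_dense (SchwartzMap.fourierTransformCLM ℂ ψ)
  refine ⟨fun n => FourierTransformInv.fourierInv (φ n), fun n => ?_, ?_⟩
  · rw [SchwartzMap.fourierTransformCLM_apply, FourierTransform.fourier_fourierInv_eq]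
    exact h1 n
  · have hcont : Continuous (fun f : SchwartzMap E ℂ => (FourierTransformInv.fourierInv f : SchwartzMap E ℂ)) :=
      ContinuousFourierInv.continuous_fourierInv
    have := (hcont.tendsto _).comp h2
    rw [SchwartzMap.fourierTransformCLM_apply, FourierTransform.fourierInv_fourier_eq] at this
    exact this

open scoped Distributions in
lemma completeSpace_DK (K : TopologicalSpace.Compacts E) : CompleteSpace 𝓓_{K}(E, ℂ) := by
  have hemb := ContDiffMapSupportedIn.isUniformEmbedding_pi_structureMapCLM (E := E) (F := ℂ) ℝ
    (n := ⊤) (K := K)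
  rw [completeSpace_iff_isComplete_range hemb.isUniformInducing]
  apply IsClosed.isComplete
  apply IsSeqClosed.isClosed
  intro u g hu hg
  choose f hf using hu
  have hlim : ∀ i : ℕ, TendstoUniformly (fun m x => iteratedFDeriv ℝ i (f m) x) (g i) atTop := by
    intro i
    have h1 := (tendsto_pi_nhds.1 hg) i
    rw [BoundedContinuousFunction.tendsto_iff_tendstoUniformly] at h1
    have h2 : (fun m x => iteratedFDeriv ℝ i (f m) x) = fun m => ⇑(u m i) := by
      funext m x
      rw [← hf m]
      simp
    rw [h2]
    exact h1
  let F : E → ℂ := fun x => (g 0 x).curry0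
  let p : E → FormalMultilinearSeries ℝ E ℂ := fun x i => g i x
  have hp : HasFTaylorSeriesUpTo ((⊤ : ℕ∞) : WithTop ℕ∞) F p := by
    refine ⟨fun x => rfl, fun i _ x => ?_, fun i _ => (g i).continuous⟩
    refine hasFDerivAt_of_tendstoUniformly (l := atTop) (f := fun m x => iteratedFDeriv ℝ i (f m) x)
      (f' := fun m x => (iteratedFDeriv ℝ (i + 1) (f m) x).curryLeft)
      (g' := fun x => (g (i + 1) x).curryLeft) ?_ ?_ ?_ x
    · have hc : UniformContinuous (fun v : ContinuousMultilinearMap ℝ (fun _ : Fin (i + 1) => E) ℂ =>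
          v.curryLeft) :=
        (continuousMultilinearCurryLeftEquiv ℝ (fun _ : Fin (i + 1) => E) ℂ).isometry.uniformContinuous
      exact hc.comp_tendstoUniformly (hlim (i + 1))
    · intro m x
      have hd : ContDiff ℝ ((⊤ : ℕ∞) : WithTop ℕ∞) (f m) := (f m).contDiff
      exact (hd.ftaylorSeries).fderiv i (by exact_mod_cast WithTop.coe_lt_top _) x
    · intro x
      exact (hlim i).tendsto_at x
  have hFs : ContDiff ℝ ((⊤ : ℕ∞) : WithTop ℕ∞) F := hp.contDiff
  have hK : Set.EqOn F 0 (K : Set E)ᶜ := by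
    intro x hx
    have h1 := (hlim 0).tendsto_at x
    have h2 : ∀ m, iteratedFDeriv ℝ 0 (f m) x = 0 := fun m =>
      (f m).iteratedFDeriv_zero_on_compl hx
    simp only [h2] at h1
    have h3 : g 0 x = 0 := (tendsto_nhds_unique h1 tendsto_const_nhds)
    simp [F, h3]
  let Φ : 𝓓_{K}(E, ℂ) := ⟨F, hFs, hK⟩
  refine ⟨Φ, ?_⟩
  ext i x : 2
  have h1 : g i x = iteratedFDeriv ℝ i F x :=
    hp.eq_iteratedFDeriv (by exact_mod_cast le_top) x
  rw [h1]
  simp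
  rfl

open scoped Distributions in
lemma barrelled_DK (K : TopologicalSpace.Compacts E) : BarrelledSpace ℂ 𝓓_{K}(E, ℂ) := by
  have := completeSpace_DK K
  have hemb := ContDiffMapSupportedIn.isUniformEmbedding_pi_structureMapCLM (E := E) (F := ℂ) ℝ
    (n := ⊤) (K := K)
  have : (uniformity 𝓓_{K}(E, ℂ)).IsCountablyGenerated := by
    rw [← hemb.isUniformInducing.comap_uniformity]
    infer_instance
  infer_instance

open scoped Distributions in
/-- uniform boundedness -/
lemma uniform_bound_DK (μ : CMeasure E) (K : TopologicalSpace.Compacts E)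
    (h : ∀ f : 𝓓_{K}(E, ℂ), IsBddFun (μ.convM f)) :
    ∃ (N : ℕ) (C : ℝ), 0 ≤ C ∧ ∀ (f : 𝓓_{K}(E, ℂ)) (P : ℝ), 0 ≤ P →
      (∀ i ≤ N, ∀ y ∈ K, ‖iteratedFDeriv ℝ i f y‖ ≤ P) → ∀ x, ‖μ.convM f x‖ ≤ C * P := by
  have := barrelled_DK K
  have := μ.locFin
  have hcs : ∀ f : 𝓓_{K}(E, ℂ), HasCompactSupport (f : E → ℂ) := fun f => f.hasCompactSupport
  have hcont : ∀ f : 𝓓_{K}(E, ℂ), Continuous (f : E → ℂ) := fun f => f.contDiff.continuous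
  have hcs' : ∀ (f : 𝓓_{K}(E, ℂ)) (x : E), HasCompactSupport (fun y => f (x - y)) := fun f x =>
    (hcs f).comp_homeomorph (Homeomorph.subLeft x)
  have hint : ∀ (f : 𝓓_{K}(E, ℂ)) (x : E),
      Integrable (fun y => f (x - y) * μ.density y) μ.tv := by
    intro f x
    have h1 : Integrable (fun y => f (x - y)) μ.tv :=
      ((hcont f).comp (by fun_prop)).integrable_of_hasCompactSupport (hcs' f x)
    refine h1.mono (h1.aestronglyMeasurable.mul μ.density_meas.aestronglyMeasurable) ?_
    filter_upwards [μ.density_norm] with s hs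
    rw [norm_mul, hs, mul_one]
  let L : E → 𝓓_{K}(E, ℂ) →ₗ[ℂ] ℂ := fun x =>
    { toFun := fun f => μ.convM f x
      map_add' := fun f g => by
        simp only [CMeasure.convM]
        rw [← integral_add (hint f x) (hint g x)]
        refine integral_congr_ae (Eventually.of_forall fun y => ?_)
        simp [add_mul]
      map_smul' := fun c f => by
        simp only [CMeasure.convM, RingHom.id_apply, smul_eq_mul]
        rw [← integral_const_mul]
        refine integral_congr_ae (Eventually.of_forall fun y => ?_)
        simp [mul_assoc] }
  let p : E → Seminorm ℂ 𝓓_{K}(E, ℂ) := fun x => (normSeminorm ℂ ℂ).comp (L x)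
  have hpa : ∀ x f, p x f = ‖μ.convM f x‖ := fun x f => rfl
  have hws := ContDiffMapSupportedIn.withSeminorms ℂ E ℂ ⊤ K
  have hpc : ∀ x, Continuous (p x) := by
    intro x
    have hKx : IsCompact ((fun y => x - y) ⁻¹' (K : Set E)) :=
      (Homeomorph.subLeft x).isCompact_preimage.2 K.isCompact
    set B : ℝ := μ.tv.real ((fun y => x - y) ⁻¹' (K : Set E)) with hB
    let b : ℝ≥0 := ⟨B, measureReal_nonneg⟩
    have hq : Continuous ((b •
        ContDiffMapSupportedIn.seminorm ℂ E ℂ ⊤ K 0 : Seminorm ℂ 𝓓_{K}(E, ℂ)) : 𝓓_{K}(E, ℂ) → ℝ) :=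
      (hws.continuous_seminorm 0).const_smul B
    refine Seminorm.continuous_of_le hq ?_
    intro f
    change ‖μ.convM f x‖ ≤ B * ContDiffMapSupportedIn.seminorm ℂ E ℂ ⊤ K 0 f
    rw [mul_comm]
    have h0 : μ.convM f x = ∫ y in (fun y => x - y) ⁻¹' (K : Set E), f (x - y) * μ.density y ∂μ.tv := by
      symm
      apply setIntegral_eq_integral_of_forall_compl_eq_zero
      intro y hy
      have : f (x - y) = 0 := f.zero_on_compl hy
      rw [this, zero_mul]
    rw [h0]
    refine norm_setIntegral_le_of_norm_le_const_ae hKx.measure_lt_top ?_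
    filter_upwards [ae_restrict_of_ae μ.density_norm] with y hy
    rw [norm_mul, hy, mul_one]
    exact ContDiffMapSupportedIn.norm_apply_le_seminorm ℂ
  have hbdd : BddAbove (Set.range p) := by
    rw [Seminorm.bddAbove_range_iff]
    intro f
    obtain ⟨C, hC⟩ := h f
    refine ⟨C, ?_⟩
    rintro _ ⟨x, rfl⟩
    exact hC x
  have hsup := Seminorm.continuous_iSup p hpc hbdd
  obtain ⟨s, C, hC, hle⟩ := Seminorm.bound_of_continuous hws (⨆ x, p x)
    (by rw [Seminorm.coe_iSup_eq hbdd]; exact hsup)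
  refine ⟨s.sup id, C, C.2, fun f P hP0 hP x => ?_⟩
  have h1 : p x f ≤ (⨆ x, p x) f := by
    rw [Seminorm.iSup_apply hbdd]
    refine le_ciSup (f := fun x => p x f) ?_ x
    obtain ⟨C, hC⟩ := h f
    refine ⟨C, ?_⟩
    rintro _ ⟨x, rfl⟩
    exact hC x
  have h2 := hle f
  rw [hpa] at h1
  refine h1.trans (h2.trans ?_)
  refine mul_le_mul_of_nonneg_left ?_ C.2
  refine Seminorm.finset_sup_apply_le hP0 fun i hi => ?_
  rw [ContDiffMapSupportedIn.seminorm_top_le_iff ℂ hP0]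
  exact hP i (Finset.le_sup (f := id) hi)

lemma convTD_eq_convM {μ : CMeasure E} {T : SchwartzMap E ℂ →L[ℂ] ℂ} (hμ : μ.Agrees T)
    (ψ : SchwartzMap E ℂ) (hψ : IsTestFn ψ) : convTD T ψ = μ.convM ψ := by
  funext x
  have h : IsTestFn (transRefl x ψ) := by
    have : HasCompactSupport (⇑ψ ∘ (Homeomorph.subLeft x)) :=
      HasCompactSupport.comp_homeomorph hψ (Homeomorph.subLeft x)
    exact this
  exact hμ _ h

lemma convM_split (μ : CMeasure E) (χ ψ : E → ℂ) (hχ : Continuous χ) (hψ : Continuous ψ)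
    (hχs : HasCompactSupport χ) (hψs : HasCompactSupport ψ) (h1 : ∫ u, χ u = 1) (x : E) :
    μ.convM ψ x = ∫ u, μ.convM (fun z => χ z * ψ (z + u)) (x - u) := by
  have := μ.locFin
  obtain ⟨R, hR⟩ := hψs.isCompact.isBounded.exists_norm_le
  obtain ⟨Q, hQ⟩ := hχs.isCompact.isBounded.exists_norm_le
  have hF : Integrable (fun p : E × E => (χ (x - p.1 - p.2) * ψ (x - p.2)))
      (volume.prod μ.tv) := by
    refine Continuous.integrable_of_hasCompactSupport (by fun_prop) ?_
    refine HasCompactSupport.intro ((isCompact_closedBall (0 : E) (Q + R)).prod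
      (isCompact_closedBall (x : E) R)) ?_
    rintro ⟨u, y⟩ hp
    by_contra hne
    have hne1 := left_ne_zero_of_mul hne
    have hne2 := right_ne_zero_of_mul hne
    have a1 := hQ _ (subset_tsupport _ hne1)
    have a2 := hR _ (subset_tsupport _ hne2)
    apply hp
    constructor
    · simp only [mem_closedBall_zero_iff]
      have : u = (x - y) - (x - u - y) := by abel
      rw [this]
      refine (norm_sub_le _ _).trans ?_
      simp only at a1 a2
      linarith
    · simp only [mem_closedBall, dist_eq_norm]
      rw [norm_sub_rev]
      exact a2
  have hF' : Integrable (fun p : E × E => (χ (x - p.1 - p.2) * ψ (x - p.2)) * μ.density p.2)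
      (volume.prod μ.tv) := by
    refine hF.mono (hF.aestronglyMeasurable.mul
      (μ.density_meas.comp measurable_snd).aestronglyMeasurable) ?_
    have : ∀ᵐ p ∂((volume : Measure E).prod μ.tv), ‖μ.density p.2‖ = 1 :=
      Measure.quasiMeasurePreserving_snd.ae μ.density_norm
    filter_upwards [this] with s hs
    rw [norm_mul _ (μ.density _), hs, mul_one]
  have h2 : ∀ u, μ.convM (fun z => χ z * ψ (z + u)) (x - u) =
      ∫ y, (χ (x - u - y) * ψ (x - y)) * μ.density y ∂μ.tv := by
    intro u
    simp only [CMeasure.convM]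
    congr 1
    funext y
    rw [show x - u - y + u = x - y by abel]
  simp only [h2]
  rw [integral_integral_swap (f := fun u y => (χ (x - u - y) * ψ (x - y)) * μ.density y) hF']
  simp only [CMeasure.convM]
  congr 1
  funext y
  simp only [mul_assoc]
  rw [integral_mul_const]
  have h3 : ∫ u, χ (x - u - y) = 1 := by
    rw [← h1, ← integral_sub_left_eq_self χ volume (x - y)]
    congr 1
    funext u
    congr 1
    abel
  rw [h3, one_mul]

lemma exists_normed_bump : ∃ χ : E → ℂ, HasCompactSupport χ ∧
    ContDiff ℝ ((⊤ : ℕ∞) : WithTop ℕ∞) χ ∧ (∀ x ∉ closedBall (0 : E) 1, χ x = 0) ∧ ∫ u, χ u = 1 := by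
  let b : ContDiffBump (0 : E) := ⟨1/2, 1, by norm_num, by norm_num⟩
  refine ⟨fun x => (b.normed volume x : ℂ), b.hasCompactSupport_normed.comp_left Complex.ofReal_zero,
    Complex.ofRealCLM.contDiff.comp b.contDiff_normed, fun x hx => ?_, ?_⟩
  · have : b.normed volume x = 0 := by
      apply image_eq_zero_of_notMem_tsupport
      rwa [b.tsupport_normed_eq]
    simp [this]
  · rw [integral_complex_ofReal, b.integral_normed]
    simp

open scoped Distributions in
lemma main_bound_test {μ : CMeasure E} {T : SchwartzMap E ℂ →L[ℂ] ℂ} (hμ : μ.Agrees T)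
    (hT : TransBddD T) : ∃ (m : ℕ × ℕ) (C : ℝ), 0 ≤ C ∧ ∀ ψ : SchwartzMap E ℂ, IsTestFn ψ → ∀ x,
      ‖convTD T ψ x‖ ≤ C * (Finset.Iic m).sup (schwartzSeminormFamily ℝ E ℂ) ψ := by
  obtain ⟨χ, hχs, hχ, hχ0, hχ1⟩ := exists_normed_bump (E := E)
  let K : TopologicalSpace.Compacts E := ⟨closedBall 0 1, isCompact_closedBall _ _⟩
  obtain ⟨N, C, hC, hN⟩ := uniform_bound_DK μ K (by
    intro f
    have h1 := hT (f.hasCompactSupport.toSchwartzMap f.contDiff) f.hasCompactSupport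
    rw [convTD_eq_convM hμ (f.hasCompactSupport.toSchwartzMap f.contDiff) f.hasCompactSupport] at h1
    exact h1)
  obtain ⟨M, hM⟩ := testfn_bound hχs hχ N
  have hM0 : 0 ≤ M := (norm_nonneg _).trans (hM 0 (Nat.zero_le _) 0)
  set k : ℕ := Module.finrank ℝ E + 1 with hk
  have hI : Integrable (fun u : E => (1 + ‖u‖) ^ (-(k : ℝ))) := by
    apply integrable_one_add_norm
    rw [hk]; push_cast; linarith
  refine ⟨(k, N), ∫ u : E, C * (2 ^ N * (M * (4 ^ k * (1 + ‖u‖) ^ (-(k : ℝ))))), ?_, ?_⟩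
  · exact integral_nonneg fun u => by positivity
  intro ψ hψ x
  rw [convTD_eq_convM hμ ψ hψ, convM_split μ χ ψ hχ.continuous ψ.continuous hχs hψ hχ1 x,
    ← integral_mul_const]
  refine norm_integral_le_of_norm_le ?_ (Eventually.of_forall fun u => ?_)
  · exact ((((hI.const_mul _).const_mul _).const_mul _).const_mul _).mul_const _
  set S := (Finset.Iic (k, N)).sup (schwartzSeminormFamily ℝ E ℂ) ψ with hS
  have hS0 : 0 ≤ S := apply_nonneg _ _
  have hψu : ContDiff ℝ ((⊤ : ℕ∞) : WithTop ℕ∞) (fun z => ψ (z + u)) :=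
    (ψ.smooth ⊤).comp (contDiff_id.add contDiff_const)
  let g : 𝓓_{K}(E, ℂ) := ⟨fun z => χ z * ψ (z + u), hχ.mul hψu, fun z hz => by
    simp [hχ0 z hz]⟩
  have key := hN g (2 ^ N * (M * (4 ^ k * (1 + ‖u‖) ^ (-(k : ℝ)) * S))) (by positivity) (by
    intro i hi y hy
    have hb : ∀ j ≤ i, ‖iteratedFDeriv ℝ j (fun z => ψ (z + u)) y‖ ≤
        4 ^ k * (1 + ‖u‖) ^ (-(k : ℝ)) * S := by
      intro j hj
      rw [iteratedFDeriv_comp_add_right]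
      have h1 := SchwartzMap.one_add_le_sup_seminorm_apply (𝕜 := ℝ) (m := (k, N)) (k := k) (n := j)
        le_rfl (hj.trans hi) ψ (y + u)
      have hy1 : ‖y‖ ≤ 1 := mem_closedBall_zero_iff.1 (show y ∈ closedBall (0 : E) 1 from hy)
      have h2 : 1 + ‖u‖ ≤ 2 * (1 + ‖y + u‖) := by
        have : ‖u‖ ≤ ‖y + u‖ + ‖y‖ := by
          have := norm_sub_le (y + u) y
          simpa using this
        linarith [norm_nonneg (y + u)]
      have h3 : (1 + ‖u‖) ^ k ≤ 2 ^ k * (1 + ‖y + u‖) ^ k := by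
        rw [← mul_pow]
        exact pow_le_pow_left₀ (by positivity) h2 k
      rw [Real.rpow_neg (by positivity), Real.rpow_natCast]
      have h4 : (1 + ‖u‖) ^ k * ‖iteratedFDeriv ℝ j ψ (y + u)‖ ≤ 4 ^ k * S := by
        calc _ ≤ (2 ^ k * (1 + ‖y + u‖) ^ k) * ‖iteratedFDeriv ℝ j ψ (y + u)‖ := by gcongr
          _ = 2 ^ k * ((1 + ‖y + u‖) ^ k * ‖iteratedFDeriv ℝ j ψ (y + u)‖) := by ring
          _ ≤ 2 ^ k * (2 ^ k * S) := mul_le_mul_of_nonneg_left h1 (by positivity)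
          _ = 4 ^ k * S := by rw [← mul_assoc, ← mul_pow]; norm_num
      rw [show (4:ℝ) ^ k * ((1 + ‖u‖) ^ k)⁻¹ * S = (4 ^ k * S) / (1 + ‖u‖) ^ k by
        rw [div_eq_mul_inv]; ring, le_div_iff₀ (by positivity), mul_comm]
      exact h4
    refine (leibniz_bound hχ hψu y i (fun j hj => hM j (hj.trans hi) y) hb).trans ?_
    gcongr
    norm_num) (x - u)
  refine key.trans (le_of_eq ?_)
  ring

lemma main_bound {μ : CMeasure E} {T : SchwartzMap E ℂ →L[ℂ] ℂ} (hμ : μ.Agrees T)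
    (hT : TransBddD T) : ∃ q : SchwartzMap E ℂ → ℝ, Continuous q ∧ q 0 = 0 ∧
      ∀ ψ x, ‖convTD T ψ x‖ ≤ q ψ := by
  obtain ⟨m, C, hC, h⟩ := main_bound_test hμ hT
  have hq : Continuous (fun ψ : SchwartzMap E ℂ =>
      C * (Finset.Iic m).sup (schwartzSeminormFamily ℝ E ℂ) ψ) := by
    refine continuous_const.mul ?_
    refine Seminorm.continuous_of_le (q := ∑ i ∈ Finset.Iic m, schwartzSeminormFamily ℝ E ℂ i) ?_
      (Seminorm.finset_sup_le_sum _ _)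
    have : ⇑(∑ i ∈ Finset.Iic m, schwartzSeminormFamily ℝ E ℂ i) =
        fun ψ => ∑ i ∈ Finset.Iic m, schwartzSeminormFamily ℝ E ℂ i ψ := by
      rw [← Finset.sum_fn]
      exact map_sum (FunLike.coeAddMonoidHom (Seminorm ℝ (SchwartzMap E ℂ)) (SchwartzMap E ℂ) ℝ) _ _
    rw [this]
    exact continuous_finsetSum _ fun i _ => (schwartz_withSeminorms ℝ E ℂ).continuous_seminorm i
  refine ⟨_, hq, by simp, fun ψ x => ?_⟩
  obtain ⟨φ, h1, h2⟩ := testfn_dense ψ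
  have hc : Continuous (fun ψ : SchwartzMap E ℂ => ‖convTD T ψ x‖) := by
    unfold convTD transRefl
    fun_prop
  exact le_of_tendsto_of_tendsto' ((hc.tendsto ψ).comp h2) ((hq.tendsto ψ).comp h2)
    fun n => h (φ n) (h1 n) x

lemma sapTD_of_transBddD {μ ν : CMeasure E} {T : SchwartzMap E ℂ →L[ℂ] ℂ} (hμ : μ.Agrees T)
    (hν : ν.Agrees (fourierTD T)) (hνpp : ν.IsPurePoint) (hT : TransBddD T) : SAPTD T := by
  obtain ⟨q, hq, hq0, h⟩ := main_bound hμ hT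
  intro ψ
  apply isBohrAP_of_approx
  intro ε hε
  obtain ⟨φ, h1, h2⟩ := fourier_testfn_dense ψ
  have h3 : Tendsto (fun n => q (ψ - φ n)) atTop (𝓝 0) := by
    have : Tendsto (fun n => ψ - φ n) atTop (𝓝 (ψ - ψ)) := tendsto_const_nhds.sub h2
    rw [sub_self] at this
    rw [← hq0]
    exact (hq.tendsto 0).comp this
  obtain ⟨n, hn⟩ := (h3.eventually (gt_mem_nhds hε)).exists
  refine ⟨convTD T (φ n), isBohrAP_convTD_of_fourier T ν hν hνpp _ (h1 n), fun x => ?_⟩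
  have h4 : convTD T ψ x - convTD T (φ n) x = convTD T (ψ - φ n) x := by
    simp only [convTD, transRefl, map_sub]
  rw [h4]
  exact (h _ x).trans hn.le

lemma integrable_conv (μ : CMeasure E) {f : E → ℂ} (hf : Continuous f) (hs : HasCompactSupport f)
    (x : E) : Integrable (fun y => f (x - y) * μ.density y) μ.tv := by
  have := μ.locFin
  have h0 : HasCompactSupport (fun y => f (x - y)) := hs.comp_homeomorph (Homeomorph.subLeft x)
  have h1 : Integrable (fun y => f (x - y)) μ.tv :=
    (hf.comp (by fun_prop)).integrable_of_hasCompactSupport h0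
  refine h1.mono (h1.aestronglyMeasurable.mul μ.density_meas.aestronglyMeasurable) ?_
  filter_upwards [μ.density_norm] with s hs
  rw [norm_mul, hs, mul_one]

lemma convM_bound (μ : CMeasure E) (hμ : μ.TransBddM) (b : E → ℂ) (hb : Continuous b)
    (hbs : HasCompactSupport b) : ∃ C : ℝ, 0 ≤ C ∧ ∀ (f : E → ℂ) (ε : ℝ), 0 ≤ ε → Continuous f →
      (∀ x, ‖f x‖ ≤ ε) → ∀ x, ‖μ.convM (fun z => b z * f z) x‖ ≤ C * ε := by
  have := μ.locFin
  have hc : ∀ f : BoundedContinuousFunction E ℂ, Continuous (fun z => b z * f z) := fun f =>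
    hb.mul f.continuous
  have hcs : ∀ f : BoundedContinuousFunction E ℂ, HasCompactSupport (fun z => b z * f z) := fun f =>
    hbs.mul_right
  let L : E → BoundedContinuousFunction E ℂ →L[ℂ] ℂ := fun x => LinearMap.mkContinuous
    { toFun := fun f => μ.convM (fun z => b z * f z) x
      map_add' := fun f g => by
        simp only [CMeasure.convM]
        rw [← integral_add (integrable_conv μ (hc f) (hcs f) x) (integrable_conv μ (hc g) (hcs g) x)]
        refine integral_congr_ae (Eventually.of_forall fun y => ?_)
        simp [mul_add, add_mul]
      map_smul' := fun c f => by
        simp only [CMeasure.convM, RingHom.id_apply, smul_eq_mul]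
        rw [← integral_const_mul]
        refine integral_congr_ae (Eventually.of_forall fun y => ?_)
        simp only [BoundedContinuousFunction.coe_smul, smul_eq_mul]
        ring }
    (∫ y, ‖b (x - y) * μ.density y‖ ∂μ.tv) (fun f => by
      rw [← integral_mul_const]
      refine norm_integral_le_of_norm_le ((integrable_conv μ hb hbs x).norm.mul_const _)
        (Eventually.of_forall fun y => ?_)
      simp only [norm_mul]
      have := f.norm_coe_le_norm (x - y)
      calc _ = (‖b (x - y)‖ * ‖μ.density y‖) * ‖f (x - y)‖ := by ring
        _ ≤ _ := by gcongr)
  obtain ⟨C, hC⟩ := banach_steinhaus (g := L) (fun f => hμ _ (hc f) (hcs f))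
  have hC0 : 0 ≤ C := (norm_nonneg _).trans (hC 0)
  refine ⟨C, hC0, fun f ε hε hf hfε x => ?_⟩
  let F : BoundedContinuousFunction E ℂ := BoundedContinuousFunction.ofNormedAddCommGroup f hf ε hfε
  have h1 : ‖L x F‖ ≤ C * ε := (L x).le_of_opNorm_le_of_le (hC x)
    (BoundedContinuousFunction.norm_ofNormedAddCommGroup_le hf hε hfε)
  exact h1

lemma sapM_of_transBddM {μ : CMeasure E} {T : SchwartzMap E ℂ →L[ℂ] ℂ} (hμ : μ.Agrees T)
    (hT : SAPD T) (hM : μ.TransBddM) : μ.SAPM := by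
  intro φ hφ hφs
  obtain ⟨R, hR0, hR⟩ := hφs.isCompact.isBounded.exists_pos_norm_le
  let b0 : ContDiffBump (0 : E) := ⟨R, R + 1, hR0, by linarith⟩
  let b : E → ℂ := fun x => (b0 x : ℂ)
  have hb : ContDiff ℝ ((⊤ : ℕ∞) : WithTop ℕ∞) b := Complex.ofRealCLM.contDiff.comp b0.contDiff
  have hbs : HasCompactSupport b := b0.hasCompactSupport.comp_left Complex.ofReal_zero
  have hbφ : ∀ x, b x * φ x = φ x := by
    intro x
    by_cases hx : φ x = 0
    · simp [hx]
    · have h1 := hR x (subset_tsupport _ hx)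
      have h2 := b0.one_of_mem_closedBall (x := x) (by simpa [b0] using h1)
      simp [b, h2]
  obtain ⟨C, hC0, hC⟩ := convM_bound μ hM b hb.continuous hbs
  apply isBohrAP_of_approx
  intro ε hε
  have hu : UniformContinuous φ := hφ.uniformContinuous_of_tendsto_cocompact
    (hφs.is_zero_at_infty)
  have hδ : 0 < ε / (C + 1) := by positivity
  obtain ⟨g, hg, hgφ⟩ := hu.exists_contDiff_dist_le hδ
  have hbg : ContDiff ℝ ((⊤ : ℕ∞) : WithTop ℕ∞) (fun z => b z * g z) := hb.mul hg
  have hbgs : HasCompactSupport (fun z => b z * g z) := hbs.mul_right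
  have h1 := hT (hbgs.toSchwartzMap hbg) hbgs
  rw [convTD_eq_convM hμ (hbgs.toSchwartzMap hbg) hbgs] at h1
  refine ⟨_, h1, fun x => ?_⟩
  have h2 := hC (fun z => φ z - g z) (ε / (C + 1)) hδ.le (hφ.sub hg.continuous) (fun z => by
    have := hgφ z
    rw [dist_comm, dist_eq_norm] at this
    exact this.le) x
  have h3 : μ.convM φ x - μ.convM (hbgs.toSchwartzMap hbg) x =
      μ.convM (fun z => b z * (φ z - g z)) x := by
    simp only [CMeasure.convM, toSchwartz_apply]
    rw [← integral_sub (integrable_conv μ hφ hφs x) (integrable_conv μ hbg.continuous hbgs x)]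
    refine integral_congr_ae (Eventually.of_forall fun y => ?_)
    simp only
    rw [mul_sub, hbφ]
    ring
  rw [h3]
  refine h2.trans ?_
  rw [mul_div_assoc', div_le_iff₀ (by positivity)]
  nlinarith

lemma sap_iff {μ ν : CMeasure E} {T : SchwartzMap E ℂ →L[ℂ] ℂ}
    (hμT : μ.Agrees T) (hνT : ν.Agrees (fourierTD T)) (hνpp : ν.IsPurePoint) :
    (SAPD T ↔ TransBddD T) ∧ (SAPTD T ↔ TransBddTD T) ∧ (μ.SAPM ↔ μ.TransBddM) := by
  have key := sapTD_of_transBddD hμT hνT hνpp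
  refine ⟨⟨fun h ψ hψ => (h ψ hψ).2.1, fun h ψ _ => key h ψ⟩,
    ⟨fun h ψ => (h ψ).2.1, fun h => key fun ψ _ => h ψ⟩,
    ⟨fun h φ hφ hs => (h φ hφ hs).2.1, fun h => ?_⟩⟩
  refine sapM_of_transBddM hμT (fun ψ _ => key (fun ψ hψ => ?_) ψ) h
  rw [convTD_eq_convM hμT ψ hψ]
  exact h ψ ψ.continuous hψ

end Work


/-- Strong almost periodicity of a Poisson measure is equivalent to
translation boundedness, as a distribution, as a tempered distribution, and as a measure. -/
theorem poisson_sap_iff_transBdd (d : ℕ)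
    (μ ν : CMeasure (EuclideanSpace ℝ (Fin d)))
    (T : SchwartzMap (EuclideanSpace ℝ (Fin d)) ℂ →L[ℂ] ℂ)
    (hμT : μ.Agrees T) (hνT : ν.Agrees (fourierTD T))
    (hμpp : μ.IsPurePoint) (hνpp : ν.IsPurePoint) :
    (SAPD T ↔ TransBddD T) ∧ (SAPTD T ↔ TransBddTD T) ∧ (μ.SAPM ↔ μ.TransBddM) := by
  exact sap_iff hμT hνT hνpp
end
end

section
/- Let T be a tempered measure on ℝ^d. Then the distributional Fourier transform T̂ is strongly almost periodic as a tempered distribution if and only if T̂ is translation bounded as a tempered distribution and T is a pure-point measure. -/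
set_option linter.unusedSectionVars false

open MeasureTheory Filter Metric Complex SchwartzMap
open scoped Topology ENNReal NNReal ComplexConjugate

noncomputable section

section AP

variable {E : Type*} [NormedAddCommGroup E] [InnerProductSpace ℝ E] [FiniteDimensional ℝ E]
  [MeasurableSpace E] [BorelSpace E]

/-- Bochner's criterion. -/
def Boch (f : E → ℂ) : Prop :=
  ∀ ε : ℝ, 0 < ε → ∃ F : Set E, F.Finite ∧ ∀ t, ∃ s ∈ F, ∀ x, ‖f (x - t) - f (x - s)‖ < ε

def AP3 (f : E → ℂ) : Prop := UniformContinuous f ∧ (∃ C : ℝ, ∀ x, ‖f x‖ ≤ C) ∧ Boch f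

lemma IsBohrAP.ap3 {f : E → ℂ} (h : IsBohrAP f) : AP3 f := by
  refine ⟨h.1, h.2.1, fun ε hε => ?_⟩
  obtain ⟨r, hr⟩ := h.2.2 (ε / 2) (by positivity)
  obtain ⟨δ, hδ, hf⟩ := Metric.uniformContinuous_iff.1 h.1 (ε / 2) (by positivity)
  have hc : IsCompact (Metric.closedBall (0 : E) r) := isCompact_closedBall 0 r
  obtain ⟨F, hF, hcov⟩ := Metric.totallyBounded_iff.1 hc.totallyBounded δ hδ
  refine ⟨F, hF, fun t => ?_⟩
  obtain ⟨a, ha, hta⟩ := hr t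
  have hm : t - a ∈ Metric.closedBall (0 : E) r := by
    rw [mem_closedBall, dist_zero_right, ← dist_eq_norm]; exact hta
  obtain ⟨s, hs, hts⟩ := Set.mem_iUnion₂.1 (hcov hm)
  refine ⟨s, hs, fun x => ?_⟩
  have h1 := ha (x - (t - a))
  have h2 : dist (f (x - (t - a))) (f (x - s)) < ε / 2 := by
    apply hf
    rw [dist_sub_left]; exact hts
  rw [show x - (t - a) - a = x - t by abel] at h1
  rw [dist_eq_norm] at h2
  calc ‖f (x - t) - f (x - s)‖ = ‖(f (x - t) - f (x - (t - a))) + (f (x - (t - a)) - f (x - s))‖ := by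
        congr 1; ring
    _ ≤ _ := norm_add_le _ _
    _ < ε := by linarith

lemma AP3.isBohrAP {f : E → ℂ} (h : AP3 f) : IsBohrAP f := by
  refine ⟨h.1, h.2.1, fun ε hε => ?_⟩
  obtain ⟨F, hF, hcov⟩ := h.2.2 ε hε
  obtain ⟨r, hr⟩ := hF.isBounded.exists_norm_le
  refine ⟨r, fun x => ?_⟩
  obtain ⟨s, hs, hxs⟩ := hcov x
  refine ⟨x - s, fun y => ?_, ?_⟩
  · have := hxs (y + s)
    rwa [show y + s - x = y - (x - s) by abel, add_sub_cancel_right] at this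
  · rw [dist_eq_norm, sub_sub_cancel]; exact hr s hs

lemma AP3.add {f g : E → ℂ} (hf : AP3 f) (hg : AP3 g) : AP3 (fun x => f x + g x) := by
  refine ⟨hf.1.add hg.1, ?_, fun ε hε => ?_⟩
  · obtain ⟨C, hC⟩ := hf.2.1
    obtain ⟨D, hD⟩ := hg.2.1
    exact ⟨C + D, fun x => (norm_add_le _ _).trans (add_le_add (hC x) (hD x))⟩
  obtain ⟨F, hF, hcF⟩ := hf.2.2 (ε / 4) (by positivity)
  obtain ⟨G, hG, hcG⟩ := hg.2.2 (ε / 4) (by positivity)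
  choose a ha haf using hcF
  choose b hb hbf using hcG
  have hfin : (Set.range (fun t => (a t, b t))).Finite :=
    (hF.prod hG).subset (by rintro _ ⟨t, rfl⟩; exact ⟨ha t, hb t⟩)
  obtain ⟨K, hK⟩ : ∃ K : Set E, K.Finite ∧ ∀ t, ∃ s ∈ K, (a s, b s) = (a t, b t) := by
    refine ⟨(fun p => Function.invFun (fun t => (a t, b t)) p) '' Set.range (fun t => (a t, b t)),
      hfin.image _, fun t => ⟨_, ⟨_, ⟨t, rfl⟩, rfl⟩, ?_⟩⟩
    exact Function.invFun_eq (f := fun t => (a t, b t)) ⟨t, rfl⟩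
  refine ⟨K, hK.1, fun t => ?_⟩
  obtain ⟨s, hs, hst⟩ := hK.2 t
  rw [Prod.mk.injEq] at hst
  refine ⟨s, hs, fun x => ?_⟩
  have h1 := haf t x
  have h2 := haf s x
  have h3 := hbf t x
  have h4 := hbf s x
  rw [hst.1] at h2
  rw [hst.2] at h4
  calc ‖f (x - t) + g (x - t) - (f (x - s) + g (x - s))‖
      = ‖(f (x - t) - f (x - a t)) - (f (x - s) - f (x - a t)) + (g (x - t) - g (x - b t))
          - (g (x - s) - g (x - b t))‖ := by congr 1; ring
    _ ≤ ‖f (x - t) - f (x - a t)‖ + ‖f (x - s) - f (x - a t)‖ + ‖g (x - t) - g (x - b t)‖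
          + ‖g (x - s) - g (x - b t)‖ :=
        (norm_sub_le _ _).trans (add_le_add_left ((norm_add_le _ _).trans
          (add_le_add_left (norm_sub_le _ _) _)) _)
    _ < ε := by linarith

lemma AP3.neg {f : E → ℂ} (hf : AP3 f) : AP3 (fun x => - f x) := by
  refine ⟨hf.1.neg, ?_, fun ε hε => ?_⟩
  · simpa using hf.2.1
  · obtain ⟨F, hF, h⟩ := hf.2.2 ε hε
    refine ⟨F, hF, fun t => ?_⟩
    obtain ⟨s, hs, h⟩ := h t
    refine ⟨s, hs, fun x => ?_⟩
    rw [← norm_neg]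
    have h' := h x
    rwa [show -(-f (x - t) - -f (x - s)) = f (x - t) - f (x - s) by ring]

lemma AP3.zero : AP3 (fun _ : E => (0 : ℂ)) :=
  ⟨uniformContinuous_const, ⟨0, by simp⟩, fun ε hε => ⟨{0}, Set.finite_singleton _, fun t =>
    ⟨0, rfl, fun x => by simpa using hε⟩⟩⟩

lemma AP3.sum {ι : Type*} (s : Finset ι) {f : ι → E → ℂ} (hf : ∀ i, AP3 (f i)) :
    AP3 (fun x => ∑ i ∈ s, f i x) := by
  classical
  induction s using Finset.induction_on with
  | empty => simpa using AP3.zero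
  | insert a s ha ih =>
    simp only [Finset.sum_insert ha]
    exact (hf a).add ih

lemma AP3.limit {f : E → ℂ} (h : ∀ ε : ℝ, 0 < ε → ∃ g, AP3 g ∧ ∀ x, ‖g x - f x‖ < ε) : AP3 f := by
  refine ⟨?_, ?_, fun ε hε => ?_⟩
  · rw [Metric.uniformContinuous_iff]
    intro ε hε
    obtain ⟨g, hg, hgf⟩ := h (ε / 3) (by positivity)
    obtain ⟨δ, hδ, hd⟩ := Metric.uniformContinuous_iff.1 hg.1 (ε / 3) (by positivity)
    refine ⟨δ, hδ, fun a b hab => ?_⟩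
    have h1 := hd hab
    have h2 := hgf a
    have h3 := hgf b
    rw [dist_eq_norm] at *
    calc ‖f a - f b‖ = ‖(g b - f b) - (g a - f a) + (g a - g b)‖ := by congr 1; ring
      _ ≤ ‖g b - f b‖ + ‖g a - f a‖ + ‖g a - g b‖ :=
        (norm_add_le _ _).trans (add_le_add_left (norm_sub_le _ _) _)
      _ < ε := by linarith
  · obtain ⟨g, hg, hgf⟩ := h 1 one_pos
    obtain ⟨C, hC⟩ := hg.2.1
    refine ⟨C + 1, fun x => ?_⟩
    calc ‖f x‖ = ‖g x - (g x - f x)‖ := by congr 1; ring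
      _ ≤ ‖g x‖ + ‖g x - f x‖ := norm_sub_le _ _
      _ ≤ C + 1 := add_le_add (hC x) (hgf x).le
  · obtain ⟨g, hg, hgf⟩ := h (ε / 3) (by positivity)
    obtain ⟨F, hF, hc⟩ := hg.2.2 (ε / 3) (by positivity)
    refine ⟨F, hF, fun t => ?_⟩
    obtain ⟨s, hs, hts⟩ := hc t
    refine ⟨s, hs, fun x => ?_⟩
    have h1 := hts x
    have h2 := hgf (x - t)
    have h3 := hgf (x - s)
    calc ‖f (x - t) - f (x - s)‖
        = ‖(g (x - s) - f (x - s)) - (g (x - t) - f (x - t)) + (g (x - t) - g (x - s))‖ := by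
          congr 1; ring
      _ ≤ ‖g (x - s) - f (x - s)‖ + ‖g (x - t) - f (x - t)‖ + ‖g (x - t) - g (x - s)‖ :=
        (norm_add_le _ _).trans (add_le_add_left (norm_sub_le _ _) _)
      _ < ε := by linarith

/-- the character -/
def ech (x ξ : E) : ℂ := cexp (-(2 * Real.pi * inner ℝ x ξ : ℝ) * I)

lemma norm_ech (x ξ : E) : ‖ech x ξ‖ = 1 := by
  unfold ech
  have := Complex.norm_exp_ofReal_mul_I (-(2 * Real.pi * inner ℝ x ξ))
  push_cast at this ⊢
  exact this

lemma ech_add (x y ξ : E) : ech (x + y) ξ = ech x ξ * ech y ξ := by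
  unfold ech
  rw [← Complex.exp_add]
  congr 1
  rw [inner_add_left]
  push_cast
  ring

lemma ech_sub (x y ξ : E) : ech (x - y) ξ = ech x ξ * ech (-y) ξ := by
  rw [sub_eq_add_neg, ech_add]

lemma ech_zero (ξ : E) : ech 0 ξ = 1 := by simp [ech]

lemma continuous_ech : Continuous (fun p : E × E => ech p.1 p.2) := by
  unfold ech; fun_prop

lemma AP3.ech_mul (ξ : E) (c : ℂ) : AP3 (fun x => ech x ξ * c) := by
  have hc : Continuous (fun x : E => ech x ξ) := continuous_ech.comp (Continuous.prodMk_left ξ)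
  have hdiff : ∀ x y : E, ‖ech x ξ * c - ech y ξ * c‖ = ‖ech (x - y) ξ - 1‖ * ‖c‖ := by
    intro x y
    have : ech x ξ = ech y ξ * ech (x - y) ξ := by rw [← ech_add]; congr 1; abel
    rw [this, show ech y ξ * ech (x - y) ξ * c - ech y ξ * c = ech y ξ * ((ech (x - y) ξ - 1) * c) by ring,
      norm_mul, norm_ech, one_mul, norm_mul]
  refine ⟨?_, ⟨‖c‖, fun x => by rw [norm_mul, norm_ech, one_mul]⟩, fun ε hε => ?_⟩
  · rw [Metric.uniformContinuous_iff]
    intro ε hε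
    have h0 : Continuous (fun x : E => ‖ech x ξ - 1‖ * ‖c‖) := by fun_prop
    obtain ⟨δ, hδ, h⟩ := Metric.continuousAt_iff.1 (h0.continuousAt (x := 0)) ε hε
    refine ⟨δ, hδ, fun a b hab => ?_⟩
    have := @h (a - b) (by rwa [dist_zero_right, ← dist_eq_norm])
    rw [dist_eq_norm, hdiff]
    simp only [ech_zero, sub_self, norm_zero, zero_mul, dist_zero_right] at this
    exact lt_of_le_of_lt (le_abs_self _) this
  · have hb : TotallyBounded (Set.range (fun x => ech (-x) ξ * c)) := by
      have : Set.range (fun x => ech (-x) ξ * c) ⊆ Metric.closedBall 0 ‖c‖ := by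
        rintro _ ⟨x, rfl⟩
        rw [mem_closedBall, dist_zero_right, norm_mul, norm_ech, one_mul]
      exact (isCompact_closedBall (0 : ℂ) ‖c‖).totallyBounded.subset this
    obtain ⟨t, hts, htf, hcov⟩ := totallyBounded_iff_subset.1 hb _ (Metric.dist_mem_uniformity hε)
    have hts' : ∀ y ∈ t, ∃ v, ech (-v) ξ * c = y := fun y hy => hts hy
    choose! g hg using hts'
    refine ⟨g '' t, htf.image _, fun u => ?_⟩
    obtain ⟨y, hy, hyu⟩ := Set.mem_iUnion₂.1 (hcov ⟨u, rfl⟩)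
    refine ⟨g y, ⟨y, hy, rfl⟩, fun x => ?_⟩
    have h1 : ‖ech (-u) ξ * c - ech (-g y) ξ * c‖ < ε := by
      have h2 := hg y hy
      rw [h2, ← dist_eq_norm]; exact hyu
    beta_reduce
    rw [ech_sub, ech_sub x, mul_assoc, mul_assoc, ← mul_sub, norm_mul, norm_ech, one_mul]
    exact h1

end AP

section Wiener

variable {E : Type*} [NormedAddCommGroup E] [InnerProductSpace ℝ E] [FiniteDimensional ℝ E]
  [MeasurableSpace E] [BorelSpace E]

lemma integrable_ech_mul {m : Measure E} {h : E → ℂ} (hh : Integrable h m) (x : E) :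
    Integrable (fun ξ => ech x ξ * h ξ) m := by
  have hc : Continuous (fun ξ : E => ech x ξ) := continuous_ech.comp (Continuous.prodMk_right x)
  exact hh.bdd_mul (c := 1) hc.aestronglyMeasurable (Eventually.of_forall fun ξ => (norm_ech x ξ).le)

lemma AP3.pp (m : Measure E) {S : Set E} (hS : S.Countable) {h : E → ℂ} (hh : Integrable h m) :
    AP3 (fun x => ∫ ξ in S, ech x ξ * h ξ ∂m) := by
  have : Countable S := hS
  have key : ∀ f : E → ℂ, Integrable f m →
      HasSum (fun a : S => m.real {(a : E)} • f a) (∫ ξ in S, f ξ ∂m) := by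
    intro f hf
    have := hasSum_integral_iUnion (μ := m) (f := f) (s := fun a : S => {(a : E)})
      (fun a => measurableSet_singleton _)
      (fun a b hab => by
        simpa [Function.onFun] using fun h => hab (Subtype.ext h)) hf.integrableOn
    simpa only [integral_singleton, Set.iUnion_of_singleton_coe] using this
  have hsum : Summable (fun a : S => ‖m.real {(a : E)} • h (a : E)‖) := (key h hh).summable.norm
  have heq : (fun x => ∫ ξ in S, ech x ξ * h ξ ∂m) =
      fun x => ∑' a : S, ech x (a : E) * (m.real {(a : E)} • h (a : E)) := by
    funext x
    rw [← (key _ (integrable_ech_mul hh x)).tsum_eq]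
    refine tsum_congr fun a => ?_
    rw [mul_smul_comm]
  rw [heq]
  have hu := tendstoUniformly_tsum (f := fun (a : S) (x : E) => ech x (a : E) * (m.real {(a : E)} • h (a : E)))
    hsum (fun a x => by rw [norm_mul, norm_ech, one_mul])
  refine AP3.limit fun ε hε => ?_
  obtain ⟨t, ht⟩ := (Metric.tendstoUniformly_iff.1 hu ε hε).exists
  refine ⟨_, AP3.sum t (fun a => AP3.ech_mul (a : E) (m.real {(a : E)} • h a)), fun x => ?_⟩
  have := ht x
  rw [dist_eq_norm, norm_sub_rev] at this
  exact this

lemma integral_ech_gauss (y w : E) (n : ℕ) :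
    ∫ t, ech (y - (n : ℝ) • t) w ∂(ProbabilityTheory.stdGaussian E)
      = ech y w * cexp (-‖(2 * Real.pi * n) • w‖ ^ 2 / 2) := by
  rw [← ProbabilityTheory.charFun_stdGaussian, charFun_apply, ← integral_const_mul]
  congr 1
  funext t
  rw [ech_sub]
  congr 1
  unfold ech
  congr 2
  rw [inner_neg_left, inner_smul_left, inner_smul_right]
  push_cast
  simp
  ring

lemma normSq_ft {m : Measure E} [SFinite m] {h : E → ℂ} (x : E) :
    ((‖∫ ξ, ech x ξ * h ξ ∂m‖ ^ 2 : ℝ) : ℂ) =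
      ∫ z, ech x (z.1 - z.2) * (h z.1 * conj (h z.2)) ∂(m.prod m) := by
  push_cast
  rw [← Complex.mul_conj', ← integral_conj, ← integral_prod_mul]
  congr 1
  funext z
  have : ech x (z.1 - z.2) = ech x z.1 * conj (ech x z.2) := by
    unfold ech
    rw [← Complex.exp_conj, ← Complex.exp_add]
    congr 1
    rw [inner_sub_right]
    simp [Complex.conj_ofNat]
    ring
  rw [this, map_mul]
  ring

lemma continuous_ft {m : Measure E} {h : E → ℂ} (hh : Integrable h m) :
    Continuous (fun x => ∫ ξ, ech x ξ * h ξ ∂m) := by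
  refine continuous_of_dominated (bound := fun ξ => ‖h ξ‖)
    (fun x => (integrable_ech_mul hh x).aestronglyMeasurable)
    (fun x => Eventually.of_forall fun ξ => by rw [norm_mul, norm_ech, one_mul]) hh.norm
    (Eventually.of_forall fun ξ => ?_)
  exact (continuous_ech.comp (Continuous.prodMk_left ξ)).mul continuous_const

lemma norm_ft_le {m : Measure E} {h : E → ℂ} (x : E) :
    ‖∫ ξ, ech x ξ * h ξ ∂m‖ ≤ ∫ ξ, ‖h ξ‖ ∂m := by
  refine (norm_integral_le_integral_norm _).trans (le_of_eq ?_)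
  congr 1; funext ξ
  rw [norm_mul, norm_ech, one_mul]

lemma wiener {m : Measure E} [SFinite m] [NullSingletonClass m] {h : E → ℂ} (hh : Integrable h m) (y : E) :
    Tendsto (fun n : ℕ => ∫ t, ‖∫ ξ, ech (y - (n : ℝ) • t) ξ * h ξ ∂m‖ ^ 2
      ∂(ProbabilityTheory.stdGaussian E)) atTop (𝓝 0) := by
  set γ := ProbabilityTheory.stdGaussian E
  have hH : Integrable (fun z : E × E => h z.1 * conj (h z.2)) (m.prod m) :=
    hh.mul_prod ((Complex.conjLIE.toContinuousLinearEquiv.integrable_comp_iff).2 hh)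
  have h1 : ∀ n : ℕ, ((∫ t, ‖∫ ξ, ech (y - (n : ℝ) • t) ξ * h ξ ∂m‖ ^ 2 ∂γ : ℝ) : ℂ) =
      ∫ z, ech y (z.1 - z.2) * cexp (-‖(2 * Real.pi * n) • (z.1 - z.2)‖ ^ 2 / 2) *
        (h z.1 * conj (h z.2)) ∂(m.prod m) := by
    intro n
    rw [← integral_complex_ofReal]
    simp_rw [normSq_ft]
    rw [integral_integral_swap]
    · congr 1
      funext z
      rw [integral_mul_const, integral_ech_gauss]
    · have := hH.comp_snd γ
      refine this.bdd_mul (c := 1) ?_ (Eventually.of_forall fun p => (norm_ech _ _).le)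
      have hc : Continuous (fun p : E × E × E => ech (y - (n : ℝ) • p.1) (p.2.1 - p.2.2)) :=
        continuous_ech.comp (f := fun p : E × E × E => (y - (n : ℝ) • p.1, p.2.1 - p.2.2))
          (by fun_prop)
      exact hc.aestronglyMeasurable
  have h2 : Tendsto (fun n : ℕ => ∫ z, ech y (z.1 - z.2) *
      cexp (-‖(2 * Real.pi * n) • (z.1 - z.2)‖ ^ 2 / 2) *
        (h z.1 * conj (h z.2)) ∂(m.prod m)) atTop (𝓝 (∫ z : E × E, 0 ∂(m.prod m))) := by
    have hb : ∀ (n : ℕ) (w : E), cexp (-‖(2 * Real.pi * n) • w‖ ^ 2 / 2) =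
        (Real.exp (-‖(2 * Real.pi * n) • w‖ ^ 2 / 2) : ℂ) := by
      intro n w; push_cast; rfl
    refine tendsto_integral_of_dominated_convergence (fun z => ‖h z.1 * conj (h z.2)‖) ?_ hH.norm ?_ ?_
    · intro n
      refine AEStronglyMeasurable.mul (Continuous.aestronglyMeasurable ?_) hH.aestronglyMeasurable
      have hc : Continuous (fun p : E × E => ech y (p.1 - p.2)) :=
        continuous_ech.comp (f := fun p : E × E => (y, p.1 - p.2)) (by fun_prop)
      exact hc.mul (by fun_prop)
    · intro n
      refine Eventually.of_forall fun z => ?_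
      rw [norm_mul, norm_mul, norm_ech, one_mul, hb, Complex.norm_real, Real.norm_eq_abs, Real.abs_exp]
      refine mul_le_of_le_one_left (norm_nonneg _) ?_
      rw [Real.exp_le_one_iff]
      have := sq_nonneg ‖(2 * Real.pi * n) • (z.1 - z.2)‖
      linarith
    · have hd : ∀ᵐ z ∂(m.prod m), z.1 ≠ z.2 := by
        have hm : MeasurableSet {z : E × E | z.1 = z.2} := measurableSet_diagonal
        have : m.prod m {z : E × E | z.1 = z.2} = 0 := by
          rw [Measure.measure_prod_null hm]
          refine Eventually.of_forall fun x => ?_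
          have : Prod.mk x ⁻¹' {z : E × E | z.1 = z.2} = {x} := by
            ext b; simp [eq_comm]
          simp [this]
        rw [ae_iff]; simpa using this
      filter_upwards [hd] with z hz
      have hw : 0 < ‖z.1 - z.2‖ := norm_pos_iff.2 (sub_ne_zero.2 hz)
      have h3 : Tendsto (fun n : ℕ => Real.exp (-‖(2 * Real.pi * n) • (z.1 - z.2)‖ ^ 2 / 2))
          atTop (𝓝 0) := by
        have h4 : (fun n : ℕ => Real.exp (-‖(2 * Real.pi * n) • (z.1 - z.2)‖ ^ 2 / 2)) =
            fun n : ℕ => Real.exp (-(((2 * Real.pi * ‖z.1 - z.2‖) ^ 2 / 2) * (n : ℝ) ^ 2)) := by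
          funext n
          congr 1
          rw [norm_smul, Real.norm_of_nonneg (by positivity)]
          ring
        rw [h4]
        refine Real.tendsto_exp_neg_atTop_nhds_zero.comp ?_
        refine Tendsto.const_mul_atTop (by positivity) ?_
        exact (tendsto_pow_atTop two_ne_zero).comp tendsto_natCast_atTop_atTop
      have h5 : Tendsto (fun n : ℕ => cexp (-‖(2 * Real.pi * n) • (z.1 - z.2)‖ ^ 2 / 2))
          atTop (𝓝 0) := by
        simp_rw [hb]
        exact_mod_cast (Complex.continuous_ofReal.tendsto 0).comp h3
      have := (h5.const_mul (ech y (z.1 - z.2))).mul_const (h z.1 * conj (h z.2))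
      simpa using this
  simp_rw [← h1] at h2
  rw [integral_zero] at h2
  exact_mod_cast (Complex.continuous_re.tendsto 0).comp h2

lemma ft_zero {m : Measure E} [SFinite m] [NullSingletonClass m] {h : E → ℂ} (hh : Integrable h m)
    (hap : Boch (fun x => ∫ ξ, ech x ξ * h ξ ∂m)) : ∫ ξ, h ξ ∂m = 0 := by
  by_contra hne
  set k : E → ℂ := fun x => ∫ ξ, ech x ξ * h ξ ∂m with hk
  have hk0 : k 0 = ∫ ξ, h ξ ∂m := by simp [hk, ech_zero]
  have hpos : 0 < ‖k 0‖ := by rw [hk0]; exact norm_pos_iff.2 hne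
  have hkc : Continuous k := continuous_ft hh
  obtain ⟨F, hF, hcov⟩ := hap (‖k 0‖ / 2) (by positivity)
  lift F to Finset E using hF
  have hlow : ∀ t, (‖k 0‖ / 2) ^ 2 ≤ ∑ s ∈ F, ‖k (s - t)‖ ^ 2 := by
    intro t
    obtain ⟨s, hs, h1⟩ := hcov t
    have h1 := h1 s
    rw [sub_self] at h1
    have h2 : ‖k 0‖ / 2 ≤ ‖k (s - t)‖ := by
      have h3 := norm_sub_norm_le (k 0) (k (s - t))
      rw [norm_sub_rev] at h3
      linarith
    calc (‖k 0‖ / 2) ^ 2 ≤ ‖k (s - t)‖ ^ 2 := by gcongr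
      _ ≤ _ := Finset.single_le_sum (f := fun s => ‖k (s - t)‖ ^ 2) (fun i _ => by positivity) hs
  set γ := ProbabilityTheory.stdGaussian E
  have hint : ∀ (y : E) (n : ℕ), Integrable (fun t => ‖k (y - (n : ℝ) • t)‖ ^ 2) γ := by
    intro y n
    have hc : Continuous (fun t => ‖k (y - (n : ℝ) • t)‖ ^ 2) := by fun_prop
    refine Integrable.of_bound hc.aestronglyMeasurable ((∫ ξ, ‖h ξ‖ ∂m) ^ 2)
      (Eventually.of_forall fun t => ?_)
    rw [Real.norm_of_nonneg (by positivity)]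
    gcongr
    exact norm_ft_le _
  have hlim : Tendsto (fun n : ℕ => ∑ s ∈ F, ∫ t, ‖k (s - (n : ℝ) • t)‖ ^ 2 ∂γ) atTop (𝓝 0) := by
    have := tendsto_finsetSum F (fun s _ => wiener hh s)
    simpa using this
  have hle : ∀ n : ℕ, (‖k 0‖ / 2) ^ 2 ≤ ∑ s ∈ F, ∫ t, ‖k (s - (n : ℝ) • t)‖ ^ 2 ∂γ := by
    intro n
    rw [← integral_finsetSum _ (fun s _ => hint s n)]
    calc (‖k 0‖ / 2) ^ 2 = ∫ t, (‖k 0‖ / 2) ^ 2 ∂γ := by simp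
      _ ≤ _ := integral_mono (integrable_const _) (integrable_finsetSum _ (fun s _ => hint s n))
          (fun t => hlow _)
  have := ge_of_tendsto' hlim hle
  have h2 : 0 < (‖k 0‖ / 2) ^ 2 := by positivity
  linarith

end Wiener

section Schw

variable {E : Type*} [NormedAddCommGroup E] [InnerProductSpace ℝ E] [FiniteDimensional ℝ E]
  [MeasurableSpace E] [BorelSpace E]

lemma iterD_sub (f g : SchwartzMap E ℂ) (n : ℕ) (x : E) :
    iteratedFDeriv ℝ n (⇑(f - g)) x = iteratedFDeriv ℝ n f x - iteratedFDeriv ℝ n g x := by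
  rw [show (⇑(f - g) : E → ℂ) = ⇑f - ⇑g from rfl]
  exact iteratedFDeriv_sub_apply (f.smooth n).contDiffAt (g.smooth n).contDiffAt

lemma schwartz_countable : (uniformity (SchwartzMap E ℂ)).IsCountablyGenerated :=
  IsUniformAddGroup.uniformity_countably_generated

lemma schwartz_complete : CompleteSpace (SchwartzMap E ℂ) := by
  have := schwartz_countable (E := E)
  refine UniformSpace.complete_of_convergent_controlled_sequences
    (fun N => {p | ∀ k n, k ≤ N → n ≤ N → SchwartzMap.seminorm ℝ k n (p.2 - p.1) ≤ (1 / 2 : ℝ) ^ N})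
    (fun N => ?_) (fun u hu => ?_)
  · rw [uniformity_eq_comap_nhds_zero]
    refine ⟨{f | ∀ k n, k ≤ N → n ≤ N → SchwartzMap.seminorm ℝ k n f ≤ (1 / 2 : ℝ) ^ N}, ?_, ?_⟩
    · rw [(schwartz_withSeminorms ℝ E ℂ).mem_nhds_iff]
      refine ⟨Finset.Iic (N, N), (1 / 2 : ℝ) ^ N, by positivity, fun f hf k n hk hn => ?_⟩
      rw [Seminorm.mem_ball_zero] at hf
      have h1 : schwartzSeminormFamily ℝ E ℂ (k, n) ≤
          (Finset.Iic (N, N)).sup (schwartzSeminormFamily ℝ E ℂ) :=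
        Finset.le_sup (Finset.mem_Iic.2 ⟨hk, hn⟩)
      exact (h1 f).trans hf.le
    · intro p hp
      exact hp
  have hu' : ∀ N m l k n, N ≤ m → N ≤ l → k ≤ N → n ≤ N →
      SchwartzMap.seminorm ℝ k n (u l - u m) ≤ (1 / 2 : ℝ) ^ N :=
    fun N m l k n hm hl hk hn => hu N m l hm hl k n hk hn
  set f : ℕ → E → ℂ := fun j => ⇑(u (j + 1) - u j) with hf
  set v : ℕ → ℕ → ℝ := fun n j => SchwartzMap.seminorm ℝ 0 n (u (j + 1) - u j) with hv
  have hfs : ∀ j, ContDiff ℝ ((⊤ : ℕ∞) : WithTop ℕ∞) (f j) := fun j => (u (j + 1) - u j).smooth ⊤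
  have hvs : ∀ n, Summable (v n) := by
    intro n
    refine Summable.of_norm_bounded_eventually_nat (g := fun j => (1 / 2 : ℝ) ^ j)
      (summable_geometric_of_lt_one (by norm_num) (by norm_num)) ?_
    filter_upwards [eventually_ge_atTop n] with j hj
    rw [Real.norm_of_nonneg (apply_nonneg _ _)]
    exact hu' j j (j + 1) 0 n le_rfl (Nat.le_succ _) (Nat.zero_le _) hj
  have hfv : ∀ (n j : ℕ) (x : E), ‖iteratedFDeriv ℝ n (f j) x‖ ≤ v n j := fun n j x =>
    SchwartzMap.norm_iteratedFDeriv_le_seminorm ℝ (u (j + 1) - u j) n x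
  set g : E → ℂ := fun x => ∑' j, f j x with hg
  have hgs : ContDiff ℝ ((⊤ : ℕ∞) : WithTop ℕ∞) g :=
    contDiff_tsum hfs (fun k _ => hvs k) (fun k i x _ => hfv k i x)
  set G : E → ℂ := ⇑(u 0) + g with hG
  have hGs : ContDiff ℝ ((⊤ : ℕ∞) : WithTop ℕ∞) G := ((u 0).smooth ⊤).add hgs
  have hlim : ∀ n x, Tendsto (fun l => iteratedFDeriv ℝ n (u l) x) atTop (𝓝 (iteratedFDeriv ℝ n G x)) := by
    intro n x
    have h1 : iteratedFDeriv ℝ n G x = iteratedFDeriv ℝ n (u 0) x + ∑' j, iteratedFDeriv ℝ n (f j) x := by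
      rw [hG, iteratedFDeriv_add_apply ((u 0).smooth n).contDiffAt
        (hgs.of_le (by exact_mod_cast le_top)).contDiffAt]
      rw [hg, iteratedFDeriv_tsum_apply hfs (fun k _ => hvs k) (fun k i x _ => hfv k i x) le_top]
    have h2 : Summable (fun j => iteratedFDeriv ℝ n (f j) x) :=
      Summable.of_norm_bounded (hvs n) (fun j => hfv n j x)
    have h3 := h2.hasSum.tendsto_sum_nat.const_add (iteratedFDeriv ℝ n (u 0) x)
    rw [← h1] at h3
    refine h3.congr fun l => ?_
    simp only [hf, iterD_sub]
    rw [Finset.sum_range_sub (fun j => iteratedFDeriv ℝ n (u j) x)]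
    abel
  have hbd : ∀ N m k n x, N ≤ m → k ≤ N → n ≤ N →
      ‖x‖ ^ k * ‖iteratedFDeriv ℝ n (u m) x - iteratedFDeriv ℝ n G x‖ ≤ (1 / 2 : ℝ) ^ N := by
    intro N m k n x hm hk hn
    have h1 : Tendsto (fun l => ‖x‖ ^ k * ‖iteratedFDeriv ℝ n (u m) x - iteratedFDeriv ℝ n (u l) x‖)
        atTop (𝓝 (‖x‖ ^ k * ‖iteratedFDeriv ℝ n (u m) x - iteratedFDeriv ℝ n G x‖)) :=
      ((hlim n x).const_sub _).norm.const_mul _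
    refine le_of_tendsto h1 ?_
    filter_upwards [eventually_ge_atTop N] with l hl
    rw [← iterD_sub]
    exact (SchwartzMap.le_seminorm ℝ k n (u m - u l) x).trans (hu' N l m k n hl hm hk hn)
  let W : SchwartzMap E ℂ :=
    { toFun := G
      smooth' := hGs
      decay' := by
        intro k n
        set N := max k n
        refine ⟨SchwartzMap.seminorm ℝ k n (u N) + (1 / 2 : ℝ) ^ N, fun x => ?_⟩
        have h1 := hbd N N k n x le_rfl (le_max_left _ _) (le_max_right _ _)
        have h2 := SchwartzMap.le_seminorm ℝ k n (u N) x
        calc ‖x‖ ^ k * ‖iteratedFDeriv ℝ n G x‖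
            ≤ ‖x‖ ^ k * (‖iteratedFDeriv ℝ n (u N) x‖ +
                ‖iteratedFDeriv ℝ n (u N) x - iteratedFDeriv ℝ n G x‖) := by
              gcongr
              have := norm_sub_le (iteratedFDeriv ℝ n (u N) x)
                (iteratedFDeriv ℝ n (u N) x - iteratedFDeriv ℝ n G x)
              rwa [sub_sub_cancel] at this
          _ ≤ _ := by rw [mul_add]; exact add_le_add h2 h1 }
  refine ⟨W, ?_⟩
  rw [(schwartz_withSeminorms ℝ E ℂ).tendsto_nhds_atTop]
  rintro ⟨k, n⟩ ε hε
  obtain ⟨M, hM⟩ := exists_pow_lt_of_lt_one hε (show (1 / 2 : ℝ) < 1 by norm_num)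
  refine ⟨max M (max k n), fun m hm => ?_⟩
  have h1 : SchwartzMap.seminorm ℝ k n (u m - W) ≤ (1 / 2 : ℝ) ^ (max M (max k n)) := by
    refine SchwartzMap.seminorm_le_bound ℝ k n _ (by positivity) fun x => ?_
    rw [iterD_sub]
    exact hbd _ m k n x hm (by simp) (by simp)
  refine lt_of_le_of_lt (h1.trans ?_) hM
  exact pow_le_pow_of_le_one (by norm_num) (by norm_num) (le_max_left _ _)

lemma schwartz_barrelled : BarrelledSpace ℂ (SchwartzMap E ℂ) := by
  have := schwartz_countable (E := E)
  have := schwartz_complete (E := E)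
  infer_instance

/-- compactly supported approximations -/
lemma schwartz_approx (φ : SchwartzMap E ℂ) : ∃ u : ℕ → SchwartzMap E ℂ,
    (∀ j, IsTestFn (u j)) ∧ Tendsto u atTop (𝓝 φ) := by
  let b : ContDiffBump (0 : E) := ⟨1, 2, one_pos, one_lt_two⟩
  let χ : E → ℂ := fun x => (b x : ℂ)
  have hχs : ContDiff ℝ ((⊤ : ℕ∞) : WithTop ℕ∞) χ :=
    Complex.ofRealCLM.contDiff.comp b.contDiff
  have hχc : HasCompactSupport χ := b.hasCompactSupport.comp_left (g := Complex.ofReal) rfl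
  let X : SchwartzMap E ℂ := hχc.toSchwartzMap hχs
  -- scaled cutoffs
  let c : ℕ → ℝ := fun j => ((j : ℝ) + 1)⁻¹
  have hc0 : ∀ j, 0 < c j := fun j => by positivity
  have hc1 : ∀ j, c j ≤ 1 := fun j => inv_le_one_of_one_le₀ (by simp)
  have hs : ∀ j, ContDiff ℝ ((⊤ : ℕ∞) : WithTop ℕ∞) (fun x => χ (c j • x) * φ x) := fun j =>
    (hχs.comp (contDiff_const_smul (c j))).mul (φ.smooth ⊤)
  have hcs : ∀ j, HasCompactSupport (fun x => χ (c j • x) * φ x) := fun j =>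
    (hχc.comp_homeomorph (Homeomorph.smulOfNeZero (c j) (hc0 j).ne')).mul_right
  refine ⟨fun j => (hcs j).toSchwartzMap (hs j), fun j => hcs j, ?_⟩
  rw [(schwartz_withSeminorms ℝ E ℂ).tendsto_nhds_atTop]
  rintro ⟨k, n⟩ ε hε
  -- derivative bounds for 1 - χ(c x)
  have hD : ∀ i, ∃ C, 0 ≤ C ∧ ∀ j x, ‖iteratedFDeriv ℝ i (fun x => χ (c j • x) - 1) x‖ ≤
      C * c j * (1 + ‖x‖) := by
    intro i
    rcases Nat.eq_zero_or_pos i with rfl | hi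
    · refine ⟨1, zero_le_one, fun j x => ?_⟩
      rw [norm_iteratedFDeriv_zero, one_mul]
      by_cases hx : ‖c j • x‖ ≤ 1
      · have : b (c j • x) = 1 := b.one_of_mem_closedBall (by simpa using hx)
        simp only [χ, this, Complex.ofReal_one, sub_self, norm_zero]
        have := hc0 j
        positivity
      · push Not at hx
        rw [norm_smul, Real.norm_of_nonneg (hc0 j).le] at hx
        have h1 : ‖χ (c j • x) - 1‖ ≤ 1 := by
          simp only [χ]
          rw [← Complex.ofReal_one, ← Complex.ofReal_sub, Complex.norm_real, Real.norm_eq_abs, abs_le]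
          have := b.nonneg (x := c j • x)
          have := b.le_one (x := c j • x)
          constructor <;> linarith
        have := hc0 j
        nlinarith
    · refine ⟨SchwartzMap.seminorm ℝ 0 i X, apply_nonneg _ _, fun j x => ?_⟩
      have h1 : iteratedFDeriv ℝ i (fun x => χ (c j • x) - 1) x =
          c j ^ i • iteratedFDeriv ℝ i χ (c j • x) := by
        have h2 : (fun x => χ (c j • x) - 1) = (fun x => χ (c j • x)) - (fun _ => (1 : ℂ)) := rfl
        have hχi : ContDiff ℝ i χ := hχs.of_le (by exact_mod_cast le_top)
        have hχci : ContDiff ℝ i (fun x => χ (c j • x)) := hχi.comp (contDiff_const_smul (c j))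
        rw [h2, iteratedFDeriv_sub_apply hχci.contDiffAt
          (contDiff_const (c := (1 : ℂ))).contDiffAt, iteratedFDeriv_const_of_ne hi.ne']
        rw [iteratedFDeriv_comp_const_smul (c j) hχi]
        simp
      rw [h1, norm_smul, norm_pow, Real.norm_of_nonneg (hc0 j).le]
      have h3 := SchwartzMap.norm_iteratedFDeriv_le_seminorm ℝ X i (c j • x)
      have h4 : c j ^ i ≤ c j := pow_le_of_le_one (hc0 j).le (hc1 j) hi.ne'
      have h5 : 0 ≤ SchwartzMap.seminorm ℝ 0 i X := apply_nonneg _ _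
      have := hc0 j
      calc c j ^ i * ‖iteratedFDeriv ℝ i χ (c j • x)‖ ≤ c j * SchwartzMap.seminorm ℝ 0 i X := by
            gcongr
            exact h3
        _ = SchwartzMap.seminorm ℝ 0 i X * c j * 1 := by ring
        _ ≤ _ := by gcongr; linarith [norm_nonneg x]
  choose C hC0 hC using hD
  set K : ℝ := ∑ i ∈ Finset.range (n + 1), (n.choose i : ℝ) * C i *
    (SchwartzMap.seminorm ℝ k (n - i) φ + SchwartzMap.seminorm ℝ (k + 1) (n - i) φ) with hK
  have hK0 : 0 ≤ K := Finset.sum_nonneg fun i _ => by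
    have := hC0 i
    have h1 : 0 ≤ SchwartzMap.seminorm ℝ k (n - i) φ := apply_nonneg _ _
    have h2 : 0 ≤ SchwartzMap.seminorm ℝ (k + 1) (n - i) φ := apply_nonneg _ _
    positivity
  have hmain : ∀ j, SchwartzMap.seminorm ℝ k n ((hcs j).toSchwartzMap (hs j) - φ) ≤ K * c j := by
    intro j
    have := hc0 j
    refine SchwartzMap.seminorm_le_bound ℝ k n _ (by positivity) fun x => ?_
    have h1 : (⇑((hcs j).toSchwartzMap (hs j) - φ) : E → ℂ) =
        fun x => (χ (c j • x) - 1) * φ x := by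
      funext x
      change χ (c j • x) * φ x - φ x = _
      ring
    rw [h1]
    have h2 := norm_iteratedFDeriv_mul_le (𝕜 := ℝ) (f := fun x => χ (c j • x) - 1) (g := φ)
      (N := ((⊤ : ℕ∞) : WithTop ℕ∞)) ((hχs.comp (contDiff_const_smul (c j))).sub contDiff_const)
      (φ.smooth ⊤) x (n := n) (by exact_mod_cast le_top)
    refine (mul_le_mul_of_nonneg_left h2 (by positivity)).trans ?_
    rw [Finset.mul_sum, hK, Finset.sum_mul]
    refine Finset.sum_le_sum fun i _ => ?_
    have h3 := hC i j x
    have h4 := SchwartzMap.le_seminorm ℝ k (n - i) φ x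
    have h5 := SchwartzMap.le_seminorm ℝ (k + 1) (n - i) φ x
    have h6 := hC0 i
    set D := ‖iteratedFDeriv ℝ (n - i) φ x‖
    calc ‖x‖ ^ k * ((n.choose i : ℝ) * ‖iteratedFDeriv ℝ i (fun x => χ (c j • x) - 1) x‖ * D)
        ≤ ‖x‖ ^ k * ((n.choose i : ℝ) * (C i * c j * (1 + ‖x‖)) * D) := by gcongr
      _ = (n.choose i : ℝ) * C i * (‖x‖ ^ k * D + ‖x‖ ^ (k + 1) * D) * c j := by ring
      _ ≤ _ := by gcongr
  have hlim : Tendsto (fun j => K * c j) atTop (𝓝 0) := by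
    have : Tendsto c atTop (𝓝 0) := by
      simpa [c] using tendsto_one_div_add_atTop_nhds_zero_nat (𝕜 := ℝ)
    simpa using this.const_mul K
  obtain ⟨j0, hj0⟩ := eventually_atTop.1 (hlim.eventually_lt_const hε)
  exact ⟨j0, fun j hj => (hmain j).trans_lt (hj0 j hj)⟩

end Schw

section Final

variable {E : Type*} [NormedAddCommGroup E] [InnerProductSpace ℝ E] [FiniteDimensional ℝ E]
  [MeasurableSpace E] [BorelSpace E]

open FourierTransform

lemma fourier_transRefl (x : E) (φ : SchwartzMap E ℂ) (ξ : E) :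
    SchwartzMap.fourierTransformCLM ℂ (transRefl x (𝓕 φ)) ξ = ech x ξ * φ ξ := by
  have h1 : φ ξ = (𝓕⁻ (𝓕 φ) : SchwartzMap E ℂ) ξ := by
    rw [FourierTransform.fourierInv_fourier_eq]
  generalize 𝓕 φ = ψ at *
  rw [h1, SchwartzMap.fourierTransformCLM_apply, SchwartzMap.fourier_coe, SchwartzMap.fourierInv_coe,
    Real.fourier_eq, Real.fourierInv_eq, ← integral_const_mul,
    ← integral_sub_left_eq_self _ volume x]
  congr 1
  funext v
  simp only [transRefl_apply, sub_sub_cancel, Circle.smul_def, smul_eq_mul, Real.fourierChar_apply,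
    ech, ← mul_assoc, ← Complex.exp_add]
  congr 2
  rw [inner_sub_left]
  push_cast
  ring

lemma conv_test (μ : CMeasure E) (T : SchwartzMap E ℂ →L[ℂ] ℂ) (hμT : μ.Agrees T)
    (φ : SchwartzMap E ℂ) (hφ : IsTestFn φ) (x : E) :
    convTD (fourierTD T) (𝓕 φ) x = ∫ ξ, ech x ξ * (φ ξ * μ.density ξ) ∂μ.tv := by
  have hfun : ⇑(SchwartzMap.fourierTransformCLM ℂ (transRefl x (𝓕 φ))) = fun ξ => ech x ξ * φ ξ :=
    funext fun ξ => fourier_transRefl x φ ξ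
  have ht : IsTestFn (SchwartzMap.fourierTransformCLM ℂ (transRefl x (𝓕 φ))) := by
    unfold IsTestFn
    rw [hfun]
    exact HasCompactSupport.mul_left hφ
  change T (SchwartzMap.fourierTransformCLM ℂ (transRefl x (𝓕 φ))) = _
  rw [hμT _ ht, CMeasure.pairing, hfun]
  simp only [mul_assoc]

lemma integrable_test (μ : CMeasure E) {φ : E → ℂ} (hc : Continuous φ) (hφ : HasCompactSupport φ) :
    Integrable (fun ξ => φ ξ * μ.density ξ) μ.tv := by
  have := μ.locFin
  exact (hc.integrable_of_hasCompactSupport hφ).mul_bdd (c := 1)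
    μ.density_meas.aestronglyMeasurable (μ.density_norm.mono fun _ h => h.le)

lemma pp_of_sap (μ : CMeasure E) (T : SchwartzMap E ℂ →L[ℂ] ℂ) (hμT : μ.Agrees T)
    (h : SAPTD (fourierTD T)) : μ.IsPurePoint := by
  have := μ.locFin
  let S : Set E := {x | 0 < μ.tv {x}}
  have hS : S.Countable := by
    have := Measure.countable_meas_level_set_pos (μ := μ.tv) (g := fun x : E => x) measurable_id
    simpa [S] using this
  have hSm : MeasurableSet S := hS.measurableSet
  let m := μ.tv.restrict Sᶜ
  have hna : NullSingletonClass m := by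
    constructor
    intro x
    rw [Measure.restrict_apply (measurableSet_singleton x)]
    by_cases hx : x ∈ S
    · have : ({x} ∩ Sᶜ : Set E) = ∅ := by
        ext y
        simp only [Set.mem_inter_iff, Set.mem_singleton_iff, Set.mem_compl_iff,
          Set.mem_empty_iff_false, iff_false, not_and, not_not]
        rintro rfl
        exact hx
      rw [this, measure_empty]
    · have h0 : μ.tv {x} = 0 := by
        simpa [S] using hx
      exact measure_mono_null Set.inter_subset_left h0
  have hz : ∀ φ : SchwartzMap E ℂ, IsTestFn φ → ∫ ξ, φ ξ * μ.density ξ ∂m = 0 := by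
    intro φ hφ
    have hi := integrable_test μ φ.continuous hφ
    have hA := (h (𝓕 φ)).ap3
    have hB := (AP3.pp μ.tv hS hi).neg
    have hC := hA.add hB
    refine ft_zero (m := m) hi.restrict ?_
    convert hC.2.2 using 1
    funext x
    have h1 := integral_add_compl hSm (integrable_ech_mul hi x)
    simp only [conv_test μ T hμT φ hφ x, ← h1]
    simp [m]
  have hli : LocallyIntegrable μ.density m := by
    intro x
    have hone : IntegrableAtFilter (fun _ : E => (1 : ℂ)) (𝓝 x) m :=
      (locallyIntegrable_const (μ := m) (1 : ℂ)) x
    obtain ⟨s, hs, hi⟩ := hone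
    refine ⟨s, hs, ?_⟩
    refine Integrable.mono' hi.norm μ.density_meas.aestronglyMeasurable ?_
    have : ∀ᵐ y ∂m, ‖μ.density y‖ = 1 := ae_restrict_of_ae μ.density_norm
    filter_upwards [ae_restrict_of_ae this] with y hy
    simp [hy]
  have h0 : ∀ᵐ x ∂m, μ.density x = 0 := by
    refine ae_eq_zero_of_integral_contDiff_smul_eq_zero hli fun g hg hgc => ?_
    have hgs : ContDiff ℝ ((⊤ : ℕ∞) : WithTop ℕ∞) (fun x => (g x : ℂ)) :=
      Complex.ofRealCLM.contDiff.comp hg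
    have hgc' : HasCompactSupport (fun x => (g x : ℂ)) := hgc.comp_left (g := Complex.ofReal) rfl
    have := hz (hgc'.toSchwartzMap hgs) hgc'
    rw [← this]
    rfl
  refine ⟨S, hS, ?_⟩
  have h1 : ∀ᵐ x ∂m, ‖μ.density x‖ = 1 := ae_restrict_of_ae μ.density_norm
  have h2 : ∀ᵐ x ∂m, False := by
    filter_upwards [h0, h1] with x hx hy
    simp [hx] at hy
  have h3 : m = 0 := by
    rw [← ae_eq_bot]
    exact Filter.eventually_false_iff_eq_bot.1 h2
  exact Measure.restrict_eq_zero.1 h3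

/-- complex-linear version of the reflected translate. -/
def transReflC (x : E) : SchwartzMap E ℂ →L[ℂ] SchwartzMap E ℂ :=
  SchwartzMap.compCLMOfAntilipschitz (K := 1) ℂ (hasTemperateGrowth_const_sub x)
    (isometry_const_sub x).antilipschitz

lemma sap_of_pp (μ : CMeasure E) (T : SchwartzMap E ℂ →L[ℂ] ℂ) (hμT : μ.Agrees T)
    (hb : TransBddTD (fourierTD T)) (hp : μ.IsPurePoint) : SAPTD (fourierTD T) := by
  obtain ⟨S, hS, hS0⟩ := hp
  let L : E → SchwartzMap E ℂ →L[ℂ] ℂ := fun x => (fourierTD T).comp (transReflC x)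
  have hL : ∀ x ψ, L x ψ = convTD (fourierTD T) ψ x := fun x ψ => rfl
  have := schwartz_barrelled (E := E)
  have heq : UniformEquicontinuous ((↑) ∘ L : E → SchwartzMap E ℂ → ℂ) := by
    refine (norm_withSeminorms ℂ ℂ).banach_steinhaus fun _ ψ => ?_
    obtain ⟨C, hC⟩ := hb ψ
    refine ⟨C, ?_⟩
    rintro _ ⟨x, rfl⟩
    exact hC x
  intro ψ
  apply AP3.isBohrAP
  apply AP3.limit
  intro ε hε
  obtain ⟨u, hu, hut⟩ := schwartz_approx (𝓕⁻ ψ : SchwartzMap E ℂ)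
  have hft : Tendsto (fun j => (𝓕 (u j) : SchwartzMap E ℂ)) atTop (𝓝 ψ) := by
    have h1 := ((SchwartzMap.fourierTransformCLM ℂ (V := E) (E := ℂ)).continuous.tendsto _).comp hut
    simp only [SchwartzMap.fourierTransformCLM_apply, FourierTransform.fourier_fourierInv_eq] at h1
    exact h1
  have hev := (Metric.equicontinuousAt_iff_right.1 (heq.equicontinuous ψ)) ε hε
  obtain ⟨j, hj⟩ := (hft.eventually hev).exists
  refine ⟨convTD (fourierTD T) (𝓕 (u j)), ?_, fun x => ?_⟩
  · have hi := integrable_test μ (u j).continuous (hu j)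
    convert AP3.pp μ.tv hS hi using 1
    funext x
    rw [conv_test μ T hμT (u j) (hu j) x, Measure.restrict_eq_self_of_ae_mem]
    exact mem_ae_iff.2 hS0
  · have := hj x
    rw [dist_comm, dist_eq_norm] at this
    exact this

end Final

/-- For a tempered measure `T` on `ℝ^d`, the Fourier transform `T̂` is
strongly almost periodic as a tempered distribution iff `T̂` is translation bounded as a
tempered distribution and `T` is pure point. -/
theorem fourier_sapTD_iff (d : ℕ)
    (μ : CMeasure (EuclideanSpace ℝ (Fin d)))
    (T : SchwartzMap (EuclideanSpace ℝ (Fin d)) ℂ →L[ℂ] ℂ)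
    (hμT : μ.Agrees T) :
    SAPTD (fourierTD T) ↔ (TransBddTD (fourierTD T) ∧ μ.IsPurePoint) := by
  constructor
  · intro h
    exact ⟨fun ψ => (h ψ).2.1, pp_of_sap μ T hμT h⟩
  · rintro ⟨hb, hp⟩
    exact sap_of_pp μ T hμT hb hp
end
end
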